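/- arXiv:1908.09365 — 2 statements merged into one kernel-verified Lean document; each statement's English description precedes it below -/
import Mathlib

section
/- Let K and B be self-adjoint compact operators on a Hilbert space H, with K positive and I + B positive (strictly positive-definite). Let λ_n denote the eigenvalues of K enumerated in decreasing order with multiplicity, with corresponding normalized eigenvectors h_n. Suppose there exist constants a > 0, B̃ > 0 (the exponent), δ > 0, b ∈ ℝ and c > 0 such that λ_n = (a n + b + O(n^{-δ}))^{-B̃} and |(B h_n, h_m)_H| ≤ c (m n)^{-(1+δ)/2} for all m, n. Then the eigenvalues 𝛌_n of the generalized eigenproblem K𝐡 = 𝛌(𝐡 + B𝐡), enumerated in decreasing order with multiplicity, satisfy 𝛌_n = (a n + b + O(n^{-δ}))^{-B̃} as n → ∞. -/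
open scoped RealInnerProductSpace
open Filter

/-- `lam n = (a * n + b + O(n ^ (-δ)))^(-B')` as `n → ∞`, where the sequence is indexed
from `0`, so that `lam n` stands for the `(n+1)`-th term of the paper. -/
def HasTwoTermAsymp (lam : ℕ → ℝ) (a b B' δ : ℝ) : Prop :=
  ∃ (r : ℕ → ℝ) (C : ℝ) (N : ℕ),
    (∀ n, N ≤ n → |r n| ≤ C * ((n : ℝ) + 1) ^ (-δ)) ∧
    ∀ n, N ≤ n → lam n = (a * ((n : ℝ) + 1) + b + r n) ^ (-B')

section Variational

variable {H : Type*} [NormedAddCommGroup H] [InnerProductSpace ℝ H]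

/-- A continuous function that is nonpositive on finite combinations of the `g i`, `n ≤ i`, is
nonpositive on all vectors that are `M`-orthogonal to the `g i`, `i < n`. -/
lemma nonpos_of_forall_tail (M : H →L[ℝ] H) (g : ℕ → H)
    (hg : ∀ n m, ⟪M (g n), g m⟫ = if n = m then 1 else 0)
    (hdense : (Submodule.span ℝ (Set.range g)).topologicalClosure = ⊤)
    (Q : H → ℝ) (hQ : Continuous Q) (n : ℕ)
    (htail : ∀ (s : Finset ℕ) (c : ℕ → ℝ), (∀ i ∈ s, n ≤ i) → Q (∑ i ∈ s, c i • g i) ≤ 0)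
    (x : H) (hx : ∀ i < n, ⟪M (g i), x⟫ = 0) : Q x ≤ 0 := by
  let P : H →L[ℝ] H := ContinuousLinearMap.id ℝ H -
    ∑ i ∈ Finset.range n, (innerSL ℝ (M (g i))).smulRight (g i)
  have hP : ∀ y, P y = y - ∑ i ∈ Finset.range n, ⟪M (g i), y⟫ • g i := by
    intro y
    simp [P]
  have hmap : Submodule.span ℝ (Set.range g) ≤
      (Submodule.span ℝ (g '' Set.Ici n)).comap (P : H →ₗ[ℝ] H) := by
    rw [Submodule.span_le]
    rintro _ ⟨j, rfl⟩
    change P (g j) ∈ Submodule.span ℝ (g '' Set.Ici n)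
    rw [hP]
    simp only [hg, ite_smul, one_smul, zero_smul, Finset.sum_ite_eq', Finset.mem_range]
    split_ifs with hj
    · simp
    · rw [sub_zero]
      exact Submodule.subset_span ⟨j, not_lt.mp hj, rfl⟩
  have hclosed : IsClosed {y | Q (P y) ≤ 0} := isClosed_le (hQ.comp P.continuous) continuous_const
  have hsub : (Submodule.span ℝ (Set.range g) : Set H) ⊆ {y | Q (P y) ≤ 0} := by
    intro y hy
    obtain ⟨l, hl, hly⟩ := (Finsupp.mem_span_image_iff_linearCombination ℝ).mp (hmap hy)
    have hly' : P y = ∑ i ∈ l.support, l i • g i := hly.symm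
    change Q (P y) ≤ 0
    rw [hly']
    exact htail _ _ fun i hi => hl hi
  have hall : x ∈ closure (Submodule.span ℝ (Set.range g) : Set H) := by
    rw [← Submodule.topologicalClosure_coe, hdense]
    trivial
  have hPx : Q (P x) ≤ 0 := closure_minimal hsub hclosed hall
  rwa [hP, Finset.sum_eq_zero fun i hi => by rw [hx i (Finset.mem_range.mp hi), zero_smul],
    sub_zero] at hPx

lemma inner_map_sum_smul_self (L : H →L[ℝ] H) (g : ℕ → H) (s : Finset ℕ) (c : ℕ → ℝ) :
    ⟪L (∑ i ∈ s, c i • g i), ∑ i ∈ s, c i • g i⟫ =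
      ∑ i ∈ s, ∑ j ∈ s, c i * c j * ⟪L (g i), g j⟫ := by
  simp only [map_sum, map_smul, sum_inner, inner_sum, real_inner_smul_left, real_inner_smul_right]
  rw [Finset.sum_comm]
  exact Finset.sum_congr rfl fun i _ => Finset.sum_congr rfl fun j _ => by ring

lemma inner_map_sum_smul_self_of_diag (L : H →L[ℝ] H) (g : ℕ → H) (d : ℕ → ℝ)
    (hL : ∀ n m, ⟪L (g n), g m⟫ = if n = m then d n else 0) (s : Finset ℕ) (c : ℕ → ℝ) :
    ⟪L (∑ i ∈ s, c i • g i), ∑ i ∈ s, c i • g i⟫ = ∑ i ∈ s, d i * c i ^ 2 := by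
  rw [inner_map_sum_smul_self]
  refine Finset.sum_congr rfl fun i hi => ?_
  simp only [hL, mul_ite, mul_zero, Finset.sum_ite_eq, hi, if_true]
  ring

lemma exists_combination_orthogonal (v f : ℕ → H) (n : ℕ) :
    ∃ c : ℕ → ℝ, (∃ i ∈ Finset.range (n + 1), c i ≠ 0) ∧
      ∀ j < n, ⟪f j, ∑ i ∈ Finset.range (n + 1), c i • v i⟫ = 0 := by
  let T : (Fin (n + 1) → ℝ) →ₗ[ℝ] (Fin n → ℝ) :=
    Matrix.toLin' (Matrix.of fun j i => ⟪f j, v i⟫)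
  have hker : LinearMap.ker T ≠ ⊥ := LinearMap.ker_ne_bot_of_finrank_lt (by simp)
  obtain ⟨w, hw, hw0⟩ := (Submodule.ne_bot_iff _).mp hker
  refine ⟨fun i => if hi : i < n + 1 then w ⟨i, hi⟩ else 0, ?_, ?_⟩
  · obtain ⟨i, hi⟩ := Function.ne_iff.mp hw0
    exact ⟨i, Finset.mem_range.mpr i.2, by simpa [Fin.is_le] using hi⟩
  · intro j hj
    have := congrFun (LinearMap.mem_ker.mp hw) ⟨j, hj⟩
    simp only [T, Matrix.toLin'_apply, Matrix.mulVec, dotProduct, Matrix.of_apply] at this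
    rw [inner_sum, Finset.sum_range]
    simpa [real_inner_smul_right, mul_comm, Fin.is_le] using this

/-- Cauchy–Schwarz for a form whose matrix is dominated by the rank one matrix `k u uᵀ`. -/
lemma abs_inner_map_sum_smul_le (B : H →L[ℝ] H) (h : ℕ → H) (u : ℕ → ℝ) (k : ℝ)
    (hk : 0 ≤ k) (hB : ∀ n m, |⟪B (h n), h m⟫| ≤ k * (u n * u m))
    (s : Finset ℕ) (c d : ℕ → ℝ) (hd : ∀ i ∈ s, 0 < d i) :
    |⟪B (∑ i ∈ s, c i • h i), ∑ i ∈ s, c i • h i⟫| ≤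
      k * (∑ i ∈ s, u i ^ 2 / d i) * ∑ i ∈ s, d i * c i ^ 2 := by
  rw [inner_map_sum_smul_self]
  have hcs : (∑ i ∈ s, u i * |c i|) ^ 2 ≤ (∑ i ∈ s, u i ^ 2 / d i) * ∑ i ∈ s, d i * c i ^ 2 := by
    refine Finset.sum_sq_le_sum_mul_sum_of_sq_le_mul s
      (fun i hi => div_nonneg (sq_nonneg _) (hd i hi).le)
      (fun i hi => mul_nonneg (hd i hi).le (sq_nonneg _)) fun i hi => ?_
    have := (hd i hi).ne'
    rw [mul_pow, sq_abs]
    field_simp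
    exact le_rfl
  calc |∑ i ∈ s, ∑ j ∈ s, c i * c j * ⟪B (h i), h j⟫|
      ≤ ∑ i ∈ s, ∑ j ∈ s, |c i| * |c j| * (k * (u i * u j)) := by
        refine (Finset.abs_sum_le_sum_abs _ _).trans (Finset.sum_le_sum fun i _ => ?_)
        refine (Finset.abs_sum_le_sum_abs _ _).trans (Finset.sum_le_sum fun j _ => ?_)
        rw [abs_mul, abs_mul]
        exact mul_le_mul_of_nonneg_left (hB i j) (by positivity)
    _ = k * (∑ i ∈ s, u i * |c i|) ^ 2 := by
        rw [sq, Finset.sum_mul_sum, Finset.mul_sum]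
        refine Finset.sum_congr rfl fun i _ => ?_
        rw [Finset.mul_sum]
        exact Finset.sum_congr rfl fun j _ => by ring
    _ ≤ _ := by
        rw [mul_assoc]
        exact mul_le_mul_of_nonneg_left hcs hk

variable {K B : H →L[ℝ] H} {lam mu u : ℕ → ℝ} {h g : ℕ → H} {k : ℝ}

lemma generalized_eigenvalue_le
    (heig : ∀ n, K (h n) = lam n • h n) (hon : Orthonormal ℝ h)
    (hcomplete : (Submodule.span ℝ (Set.range h)).topologicalClosure = ⊤)
    (hk : 0 ≤ k) (hB : ∀ n m, |⟪B (h n), h m⟫| ≤ k * (u n * u m))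
    (hmanti : Antitone mu) (hgeig : ∀ n, K (g n) = mu n • (g n + B (g n)))
    (hgon : ∀ n m, ⟪g n + B (g n), g m⟫ = if n = m then 1 else 0)
    (n : ℕ) (t : ℝ) (ht : 0 ≤ t) (hlt : ∀ m, n ≤ m → lam m < t)
    (hsum : ∀ s : Finset ℕ, (∀ m ∈ s, n ≤ m) → t * k * ∑ m ∈ s, u m ^ 2 / (t - lam m) ≤ 1) :
    mu n ≤ t := by
  by_contra! hcon
  obtain ⟨c, ⟨i₀, hi₀, hci₀⟩, hc⟩ := exists_combination_orthogonal g h n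
  have hhon : ∀ n m, ⟪ContinuousLinearMap.id ℝ H (h n), h m⟫ = if n = m then 1 else 0 :=
    fun n m => orthonormal_iff_ite.mp hon n m
  set L : H →L[ℝ] H := K - t • (ContinuousLinearMap.id ℝ H + B) with hLdef
  have hQ : ⟪L (∑ i ∈ Finset.range (n + 1), c i • g i),
      ∑ i ∈ Finset.range (n + 1), c i • g i⟫ ≤ 0 := by
    refine nonpos_of_forall_tail (ContinuousLinearMap.id ℝ H) h hhon hcomplete
      (fun y => ⟪L y, y⟫) (by fun_prop) n (fun s e hs => ?_) _ hc
    have hD : ⟪(K - t • ContinuousLinearMap.id ℝ H) (∑ i ∈ s, e i • h i),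
        ∑ i ∈ s, e i • h i⟫ = ∑ i ∈ s, (lam i - t) * e i ^ 2 := by
      refine inner_map_sum_smul_self_of_diag _ h (fun i => lam i - t) (fun p q => ?_) s e
      have := orthonormal_iff_ite.mp hon p q
      simp only [sub_apply, smul_apply,
        ContinuousLinearMap.id_apply, heig, inner_sub_left, real_inner_smul_left, this]
      split_ifs <;> ring
    have hbd := abs_inner_map_sum_smul_le B h u k hk hB s e (fun i => t - lam i)
      fun i hi => sub_pos.mpr (hlt i (hs i hi))
    have hpos : 0 ≤ ∑ i ∈ s, (t - lam i) * e i ^ 2 := Finset.sum_nonneg fun i hi =>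
      mul_nonneg (sub_pos.mpr (hlt i (hs i hi))).le (sq_nonneg _)
    have hneg : ∑ i ∈ s, (lam i - t) * e i ^ 2 = -∑ i ∈ s, (t - lam i) * e i ^ 2 := by
      rw [← Finset.sum_neg_distrib]
      exact Finset.sum_congr rfl fun i _ => by ring
    have hsplit : ∀ y, ⟪L y, y⟫ = ⟪(K - t • ContinuousLinearMap.id ℝ H) y, y⟫ - t * ⟪B y, y⟫ := by
      intro y
      simp only [hLdef, sub_apply, smul_apply,
        add_apply, inner_sub_left, real_inner_smul_left, inner_add_left]
      ring
    change ⟪L _, _⟫ ≤ 0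
    rw [hsplit, hD, hneg]
    have h1 := mul_le_mul_of_nonneg_left (neg_le_of_abs_le hbd) ht
    have h2 := mul_le_mul_of_nonneg_right (hsum s hs) hpos
    linarith
  rw [inner_map_sum_smul_self_of_diag L g (fun i => mu i - t)] at hQ
  · refine absurd hQ (not_le.mpr ?_)
    refine Finset.sum_pos' (fun i hi => mul_nonneg ?_ (sq_nonneg _)) ⟨i₀, hi₀, ?_⟩
    · linarith [hmanti (Nat.lt_succ_iff.mp (Finset.mem_range.mp hi))]
    · have := hmanti (Nat.lt_succ_iff.mp (Finset.mem_range.mp hi₀))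
      exact mul_pos (by linarith) (by positivity)
  · intro p q
    simp only [hLdef, sub_apply, smul_apply,
      add_apply, ContinuousLinearMap.id_apply, hgeig, inner_sub_left,
      real_inner_smul_left, hgon]
    split_ifs <;> ring

lemma le_generalized_eigenvalue
    (hIBpos : ∃ c₀ > (0 : ℝ), ∀ x : H, c₀ * ‖x‖ ^ 2 ≤ ⟪x + B x, x⟫)
    (heig : ∀ n, K (h n) = lam n • h n) (hon : Orthonormal ℝ h)
    (hk : 0 ≤ k) (hB : ∀ n m, |⟪B (h n), h m⟫| ≤ k * (u n * u m))
    (hmanti : Antitone mu) (hgeig : ∀ n, K (g n) = mu n • (g n + B (g n)))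
    (hgon : ∀ n m, ⟪g n + B (g n), g m⟫ = if n = m then 1 else 0)
    (hgcomplete : (Submodule.span ℝ (Set.range g)).topologicalClosure = ⊤)
    (n : ℕ) (t : ℝ) (ht : 0 ≤ t) (hlt : ∀ m ≤ n, t < lam m)
    (hsum : t * k * ∑ m ∈ Finset.range (n + 1), u m ^ 2 / (lam m - t) ≤ 1) :
    t ≤ mu n := by
  obtain ⟨c, ⟨i₀, hi₀, hci₀⟩, hc⟩ := exists_combination_orthogonal h (fun i => g i + B (g i)) n
  set x := ∑ i ∈ Finset.range (n + 1), c i • h i with hx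
  have hlt' : ∀ i ∈ Finset.range (n + 1), 0 < lam i - t := fun i hi =>
    sub_pos.mpr (hlt i (Nat.lt_succ_iff.mp (Finset.mem_range.mp hi)))
  have hup : ⟪K x, x⟫ - mu n * ⟪x + B x, x⟫ ≤ 0 := by
    refine nonpos_of_forall_tail (ContinuousLinearMap.id ℝ H + B) g hgon hgcomplete
      (fun y => ⟪K y, y⟫ - mu n * ⟪y + B y, y⟫) (by fun_prop) n (fun s e hs => ?_) _ hc
    have h1 := inner_map_sum_smul_self_of_diag K g mu (fun p q => by
      rw [hgeig, real_inner_smul_left, hgon]; split_ifs <;> ring) s e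
    have h2 := inner_map_sum_smul_self_of_diag (ContinuousLinearMap.id ℝ H + B) g (fun _ => 1)
      hgon s e
    simp only [add_apply, ContinuousLinearMap.id_apply, one_mul] at h2
    rw [h1, h2, Finset.mul_sum, ← Finset.sum_sub_distrib]
    refine Finset.sum_nonpos fun i hi => ?_
    rw [← sub_mul]
    exact mul_nonpos_of_nonpos_of_nonneg (sub_nonpos.mpr (hmanti (hs i hi))) (sq_nonneg _)
  have hD : ⟪(K - t • ContinuousLinearMap.id ℝ H) x, x⟫ =
      ∑ i ∈ Finset.range (n + 1), (lam i - t) * c i ^ 2 := by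
    refine inner_map_sum_smul_self_of_diag _ h (fun i => lam i - t) (fun p q => ?_) _ c
    have := orthonormal_iff_ite.mp hon p q
    simp only [sub_apply, smul_apply,
      ContinuousLinearMap.id_apply, heig, inner_sub_left, real_inner_smul_left, this]
    split_ifs <;> ring
  have hbd := abs_inner_map_sum_smul_le B h u k hk hB _ c (fun i => lam i - t) hlt'
  rw [← hx] at hbd
  have hpos : 0 ≤ ∑ i ∈ Finset.range (n + 1), (lam i - t) * c i ^ 2 := Finset.sum_nonneg
    fun i hi => mul_nonneg (hlt' i hi).le (sq_nonneg _)
  have hlow : t * ⟪x + B x, x⟫ ≤ ⟪K x, x⟫ := by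
    have h1 := mul_le_mul_of_nonneg_left (le_of_abs_le hbd) ht
    have h2 := mul_le_mul_of_nonneg_right hsum hpos
    simp only [sub_apply, smul_apply,
      ContinuousLinearMap.id_apply, inner_sub_left, real_inner_smul_left] at hD
    rw [inner_add_left]
    linarith
  have hx0 : x ≠ 0 := fun h0 =>
    hci₀ (linearIndependent_iff'.mp hon.linearIndependent _ c (hx ▸ h0) i₀ hi₀)
  have hMx : 0 < ⟪x + B x, x⟫ := by
    obtain ⟨c₀, hc₀, hM⟩ := hIBpos
    have := norm_pos_iff.mpr hx0
    exact lt_of_lt_of_le (by positivity) (hM x)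
  exact le_of_mul_le_mul_right (by linarith) hMx

end Variational

section Asymptotics

/-- Bernoulli's inequality in the form needed for ratios of eigenvalues. -/
lemma mul_one_sub_le_one_sub_rpow {y γ β : ℝ} (hy : 0 < y) (hy1 : y ≤ 1) (hγ : 0 ≤ γ)
    (hγ1 : γ ≤ 1) (hγβ : γ ≤ β) : γ * (1 - y) ≤ 1 - y ^ β := by
  have h1 := rpow_one_add_le_one_add_mul_self (s := y - 1) (by linarith) hγ hγ1
  rw [add_sub_cancel] at h1
  have h2 := Real.rpow_le_rpow_of_exponent_ge hy hy1 hγβ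
  linarith

lemma rpow_neg_div_sub_le {x s γ β : ℝ} (hs : 0 < s) (hsx : s < x) (hγ : 0 < γ)
    (hγ1 : γ ≤ 1) (hγβ : γ ≤ β) :
    s ^ (-β) / (s ^ (-β) - x ^ (-β)) ≤ γ⁻¹ * (x / (x - s)) := by
  have hx : 0 < x := hs.trans hsx
  have hb := mul_one_sub_le_one_sub_rpow (div_pos hs hx) ((div_le_one hx).mpr hsx.le) hγ.le hγ1 hγβ
  have hpos : 0 < γ * (1 - s / x) := mul_pos hγ (sub_pos.mpr ((div_lt_one hx).mpr hsx))
  have hsp := Real.rpow_pos_of_pos hs β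
  have hxp := Real.rpow_pos_of_pos hx β
  have h1 : s ^ (-β) / (s ^ (-β) - x ^ (-β)) = (1 - (s / x) ^ β)⁻¹ := by
    rw [Real.rpow_neg hs.le, Real.rpow_neg hx.le, Real.div_rpow hs.le hx.le]
    have h0 : 1 - s ^ β / x ^ β ≠ 0 := by
      rw [← Real.div_rpow hs.le hx.le]
      linarith
    have h0' : x ^ β - s ^ β ≠ 0 := by
      intro h
      apply h0
      rw [sub_eq_zero.mp h, div_self hsp.ne', sub_self]
    field_simp
  have h2 : γ⁻¹ * (x / (x - s)) = (γ * (1 - s / x))⁻¹ := by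
    have : x - s ≠ 0 := (sub_pos.mpr hsx).ne'
    field_simp
  rw [h1, h2]
  exact inv_anti₀ hpos hb

lemma rpow_neg_div_sub_le' {x s γ β : ℝ} (hx : 0 < x) (hxs : x < s) (hγ : 0 < γ)
    (hγ1 : γ ≤ 1) (hγβ : γ ≤ β) :
    s ^ (-β) / (x ^ (-β) - s ^ (-β)) ≤ γ⁻¹ * (s ^ (1 - γ) * x ^ γ / (s - x)) := by
  have hs : 0 < s := hx.trans hxs
  have hy : 0 < x / s := div_pos hx hs
  have hy1 : x / s < 1 := (div_lt_one hs).mpr hxs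
  have hb := mul_one_sub_le_one_sub_rpow hy hy1.le hγ.le hγ1 hγβ
  have hpos : 0 < γ * (1 - x / s) := mul_pos hγ (sub_pos.mpr hy1)
  have hsp := Real.rpow_pos_of_pos hs β
  have hxp := Real.rpow_pos_of_pos hx β
  have h1 : s ^ (-β) / (x ^ (-β) - s ^ (-β)) = (x / s) ^ β / (1 - (x / s) ^ β) := by
    rw [Real.rpow_neg hs.le, Real.rpow_neg hx.le, Real.div_rpow hx.le hs.le]
    have h0 : 1 - x ^ β / s ^ β ≠ 0 := by
      rw [← Real.div_rpow hx.le hs.le]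
      linarith
    have h0' : s ^ β - x ^ β ≠ 0 := by
      intro h
      apply h0
      rw [sub_eq_zero.mp h, div_self hxp.ne', sub_self]
    field_simp
  have h2 : γ⁻¹ * (s ^ (1 - γ) * x ^ γ / (s - x)) = (x / s) ^ γ / (γ * (1 - x / s)) := by
    have : s - x ≠ 0 := (sub_pos.mpr hxs).ne'
    rw [Real.div_rpow hx.le hs.le, Real.rpow_sub hs, Real.rpow_one]
    have := Real.rpow_pos_of_pos hs γ
    field_simp
  rw [h1, h2]
  exact div_le_div₀ (Real.rpow_nonneg hy.le _)
    (Real.rpow_le_rpow_of_exponent_ge hy hy1.le hγβ) hpos hb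

lemma tendsto_natCast_add_one_rpow_neg {p : ℝ} (hp : 0 < p) :
    Tendsto (fun n : ℕ => ((n : ℝ) + 1) ^ (-p)) atTop (nhds 0) :=
  (tendsto_rpow_neg_atTop hp).comp
    (tendsto_atTop_add_const_right _ _ tendsto_natCast_atTop_atTop)

lemma rpow_neg_le_one {p : ℝ} (hp : 0 ≤ p) (n : ℕ) : ((n : ℝ) + 1) ^ (-p) ≤ 1 :=
  Real.rpow_le_one_of_one_le_of_nonpos (by linarith [n.cast_nonneg (α := ℝ)]) (by linarith)

lemma exists_sum_rpow_le {p : ℝ} (hp : 0 < p) :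
    ∃ Z : ℝ, 0 ≤ Z ∧ ∀ s : Finset ℕ, ∑ k ∈ s, ((k : ℝ) + 1) ^ (-1 - p) ≤ Z := by
  have hsum : Summable fun k : ℕ => ((k : ℝ) + 1) ^ (-1 - p) := by
    have := (summable_nat_add_iff 1).mpr (Real.summable_nat_rpow (p := -1 - p).mpr (by linarith))
    simpa using this
  have hnn : ∀ k : ℕ, 0 ≤ ((k : ℝ) + 1) ^ (-1 - p) := fun k => by positivity
  exact ⟨_, tsum_nonneg hnn, fun s => hsum.sum_le_tsum s fun k _ => hnn k⟩

variable {φ : ℕ → ℝ} {a b C δ : ℝ}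

lemma le_linear_of_abs_sub_le (hδ : 0 < δ) (hC : 0 ≤ C)
    (hφ : ∀ m : ℕ, |φ m - a * ((m : ℝ) + 1) - b| ≤ C * ((m : ℝ) + 1) ^ (-δ)) (m : ℕ) :
    φ m ≤ (a + |b| + C) * ((m : ℝ) + 1) := by
  have h1 := le_of_abs_le (hφ m)
  have h2 := mul_le_mul_of_nonneg_left (rpow_neg_le_one hδ.le m) hC
  have hm : (0 : ℝ) ≤ m := m.cast_nonneg
  nlinarith [le_abs_self b, abs_nonneg b]

/-- The weighted sum controlling the upper bound for the `n`-th perturbed eigenvalue. -/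
lemma exists_upper_sum_le (ha : 0 < a) (hδ : 0 < δ) (hC : 0 ≤ C) (hmono : Monotone φ)
    (hpos : ∀ m, 0 < φ m)
    (hφ : ∀ m : ℕ, |φ m - a * ((m : ℝ) + 1) - b| ≤ C * ((m : ℝ) + 1) ^ (-δ))
    {κ : ℝ} (hκ : 0 < κ) :
    ∃ E₀ : ℝ, ∀ E, E₀ ≤ E → 0 < E → ∀ᶠ n : ℕ in atTop,
      0 < φ n - E * ((n : ℝ) + 1) ^ (-δ) ∧
      ∀ s : Finset ℕ, (∀ m ∈ s, n ≤ m) →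
        ∑ m ∈ s, ((m : ℝ) + 1) ^ (-1 - δ) *
          (φ m / (φ m - (φ n - E * ((n : ℝ) + 1) ^ (-δ)))) ≤ κ := by
  obtain ⟨Z, hZ0, hZ⟩ := exists_sum_rpow_le (p := δ / 2) (by positivity)
  set A := a + |b| + C with hA
  have hA0 : 0 < A := by positivity
  refine ⟨max (2 * C) (2 * A / κ), fun E hE hE0 => ?_⟩
  have hE1 := (le_max_left _ _).trans hE
  have hE2 := (le_max_right _ _).trans hE
  have hAE : A / E ≤ κ / 2 := by
    rw [div_le_iff₀ hκ] at hE2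
    rw [div_le_iff₀ hE0]
    linarith
  have ev1 : ∀ᶠ n : ℕ in atTop, E * ((n : ℝ) + 1) ^ (-δ) < φ 0 := by
    have := (tendsto_natCast_add_one_rpow_neg hδ).const_mul E
    rw [mul_zero] at this
    exact this.eventually_lt_const (hpos 0)
  have ev2 : ∀ᶠ n : ℕ in atTop, A / a * Z * ((n : ℝ) + 1) ^ (-(δ / 2)) < κ / 2 := by
    have := (tendsto_natCast_add_one_rpow_neg (half_pos hδ)).const_mul (A / a * Z)
    rw [mul_zero] at this
    exact this.eventually_lt_const (half_pos hκ)
  filter_upwards [ev1, ev2] with n h1 h2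
  have hνn : 0 < ((n : ℝ) + 1) ^ (-δ) := by positivity
  refine ⟨by linarith [hmono (Nat.zero_le n)], fun s hs => ?_⟩
  set f : ℕ → ℝ := fun m => ((m : ℝ) + 1) ^ (-1 - δ) *
    (φ m / (φ m - (φ n - E * ((n : ℝ) + 1) ^ (-δ)))) with hf
  have hden : ∀ m, n ≤ m → 0 < φ m - (φ n - E * ((n : ℝ) + 1) ^ (-δ)) := fun m hm => by
    have := hmono hm
    have : 0 < E * ((n : ℝ) + 1) ^ (-δ) := by positivity
    linarith
  have hfle : ∀ m, n ≤ m → ∀ d, 0 < d → d ≤ φ m - (φ n - E * ((n : ℝ) + 1) ^ (-δ)) →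
      f m ≤ A * (((m : ℝ) + 1) ^ (-δ) / d) := fun m hm d hd hdle => by
    have hm1 : (0 : ℝ) < (m : ℝ) + 1 := by positivity
    calc f m ≤ ((m : ℝ) + 1) ^ (-1 - δ) * (A * ((m : ℝ) + 1) / d) := by
          refine mul_le_mul_of_nonneg_left ?_ (by positivity)
          exact div_le_div₀ (by positivity) (le_linear_of_abs_sub_le hδ hC hφ m) hd hdle
      _ = _ := by
          rw [show -1 - δ = -δ - 1 by ring, Real.rpow_sub_one hm1.ne']
          field_simp
  have hfn : f n ≤ κ / 2 := by
    refine (hfle n le_rfl (E * ((n : ℝ) + 1) ^ (-δ)) (by positivity) (by linarith)).trans ?_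
    refine le_of_eq_of_le ?_ hAE
    field_simp
  have hftail : ∀ m ∈ s.erase n, f m ≤
      A / a * ((n : ℝ) + 1) ^ (-(δ / 2)) * (((m - (n + 1) : ℕ) : ℝ) + 1) ^ (-1 - δ / 2) := by
    intro m hm
    have hnm : n + 1 ≤ m := by
      have := hs m (Finset.mem_of_mem_erase hm)
      have := Finset.ne_of_mem_erase hm
      omega
    obtain ⟨j, rfl⟩ := Nat.exists_eq_add_of_le hnm
    have hj1 : (0 : ℝ) < (j : ℝ) + 1 := by positivity
    have hn1 : (0 : ℝ) < (n : ℝ) + 1 := by positivity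
    have hcast : (((n + 1 + j : ℕ) : ℝ) + 1) = ((n : ℝ) + 1) + ((j : ℝ) + 1) := by
      push_cast; ring
    have hνle : (((n + 1 + j : ℕ) : ℝ) + 1) ^ (-δ) ≤ ((n : ℝ) + 1) ^ (-δ) := by
      rw [hcast]
      exact Real.rpow_le_rpow_of_nonpos hn1 (by linarith) (by linarith)
    have hgap : a * ((j : ℝ) + 1) ≤
        φ (n + 1 + j) - (φ n - E * ((n : ℝ) + 1) ^ (-δ)) := by
      have e1 := neg_le_of_abs_le (hφ (n + 1 + j))
      have e2 := le_of_abs_le (hφ n)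
      have e3 := mul_le_mul_of_nonneg_left hνle hC
      have e4 := mul_le_mul_of_nonneg_right hE1 hνn.le
      rw [hcast] at e1 e3
      nlinarith
    refine (hfle _ (by omega) _ (by positivity) hgap).trans ?_
    have hsplit : (((n + 1 + j : ℕ) : ℝ) + 1) ^ (-δ) ≤
        ((n : ℝ) + 1) ^ (-(δ / 2)) * ((j : ℝ) + 1) ^ (-(δ / 2)) := by
      rw [hcast, show -δ = -(δ / 2) + -(δ / 2) by ring, Real.rpow_add (by positivity)]
      exact mul_le_mul (Real.rpow_le_rpow_of_nonpos hn1 (by linarith) (by linarith))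
        (Real.rpow_le_rpow_of_nonpos hj1 (by linarith) (by linarith)) (by positivity)
        (by positivity)
    rw [Nat.add_sub_cancel_left, show -1 - δ / 2 = -(δ / 2) - 1 by ring,
      Real.rpow_sub_one hj1.ne']
    calc A * ((((n + 1 + j : ℕ) : ℝ) + 1) ^ (-δ) / (a * ((j : ℝ) + 1)))
        ≤ A * (((n : ℝ) + 1) ^ (-(δ / 2)) * ((j : ℝ) + 1) ^ (-(δ / 2)) /
          (a * ((j : ℝ) + 1))) := by gcongr
      _ = _ := by field_simp
  have hinj : Set.InjOn (fun m => m - (n + 1)) (s.erase n : Set ℕ) := by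
    have key : ∀ m ∈ s.erase n, n + 1 ≤ m := fun m hm => by
      have := hs m (Finset.mem_of_mem_erase hm)
      have := Finset.ne_of_mem_erase hm
      omega
    intro x hx y hy hxy
    have := key x hx
    have := key y hy
    simp only at hxy
    omega
  have htail : ∑ m ∈ s.erase n, f m ≤ κ / 2 := by
    refine (Finset.sum_le_sum hftail).trans ?_
    rw [← Finset.mul_sum]
    have := hZ ((s.erase n).image fun m => m - (n + 1))
    rw [Finset.sum_image hinj] at this
    calc _ ≤ A / a * ((n : ℝ) + 1) ^ (-(δ / 2)) * Z :=
          mul_le_mul_of_nonneg_left this (by positivity)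
      _ ≤ κ / 2 := by linarith
  by_cases hn : n ∈ s
  · rw [← Finset.add_sum_erase s f hn]
    linarith
  · rw [Finset.erase_eq_of_notMem hn] at htail
    linarith

/-- The weighted sum controlling the lower bound for the `n`-th perturbed eigenvalue. -/
lemma exists_lower_sum_le (ha : 0 < a) (hδ : 0 < δ) (hC : 0 ≤ C)
    (hpos : ∀ m, 0 < φ m)
    (hφ : ∀ m : ℕ, |φ m - a * ((m : ℝ) + 1) - b| ≤ C * ((m : ℝ) + 1) ^ (-δ))
    {γ : ℝ} (hγ : 0 < γ) (hγ1 : γ ≤ 1) (hγδ : γ ≤ δ / 2) {κ : ℝ} (hκ : 0 < κ) :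
    ∃ E₀ : ℝ, ∀ E, E₀ ≤ E → 0 < E → ∀ᶠ n : ℕ in atTop,
      ∑ m ∈ Finset.range (n + 1), ((m : ℝ) + 1) ^ (-1 - δ) *
        ((φ n + E * ((n : ℝ) + 1) ^ (-δ)) ^ (1 - γ) * φ m ^ γ /
          (φ n + E * ((n : ℝ) + 1) ^ (-δ) - φ m)) ≤ κ := by
  obtain ⟨Z, hZ0, hZ⟩ := exists_sum_rpow_le (p := δ / 2) (by positivity)
  obtain ⟨Y, hY0, hY⟩ := exists_sum_rpow_le (p := γ / 2) (by positivity)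
  set A := a + |b| + C + 1 with hA
  have hA0 : 0 < A := by positivity
  refine ⟨max (C * (1 + 2 ^ δ)) (2 * A / κ), fun E hE hE0 => ?_⟩
  have hE1 := (le_max_left _ _).trans hE
  have hE2 := (le_max_right _ _).trans hE
  have h2δ : (0 : ℝ) < 2 ^ δ := by positivity
  have hAE : A / E ≤ κ / 2 := by
    rw [div_le_iff₀ hκ] at hE2
    rw [div_le_iff₀ hE0]
    linarith
  have ev1 : ∀ᶠ n : ℕ in atTop, E * ((n : ℝ) + 1) ^ (-δ) < 1 := by
    have := (tendsto_natCast_add_one_rpow_neg hδ).const_mul E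
    rw [mul_zero] at this
    exact this.eventually_lt_const one_pos
  have ev2 : ∀ᶠ n : ℕ in atTop,
      2 * A / a * (Z + Y) * ((n : ℝ) + 1) ^ (-(γ / 2)) < κ / 2 := by
    have := (tendsto_natCast_add_one_rpow_neg (half_pos hγ)).const_mul (2 * A / a * (Z + Y))
    rw [mul_zero] at this
    exact this.eventually_lt_const (half_pos hκ)
  have ev3 : ∀ᶠ n : ℕ in atTop, 4 * C / a ≤ (n : ℝ) :=
    tendsto_natCast_atTop_atTop.eventually_ge_atTop _
  filter_upwards [ev1, ev2, ev3] with n h1 h2 h3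
  rw [div_le_iff₀ ha] at h3
  have hn1 : (0 : ℝ) < (n : ℝ) + 1 := by positivity
  have hνn : 0 < ((n : ℝ) + 1) ^ (-δ) := by positivity
  set σ := φ n + E * ((n : ℝ) + 1) ^ (-δ) with hσ
  have hEν : 0 < E * ((n : ℝ) + 1) ^ (-δ) := by positivity
  have hσ0 : 0 < σ := add_pos (hpos n) hEν
  have hφle : ∀ m : ℕ, φ m ≤ A * ((m : ℝ) + 1) := fun m =>
    (le_linear_of_abs_sub_le hδ hC hφ m).trans
      (mul_le_mul_of_nonneg_right (by linarith) (by positivity))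
  have hσle : σ ≤ A * ((n : ℝ) + 1) := by
    have := le_linear_of_abs_sub_le hδ hC hφ n
    have : (0 : ℝ) ≤ n := n.cast_nonneg
    nlinarith
  set f : ℕ → ℝ := fun m => ((m : ℝ) + 1) ^ (-1 - δ) * (σ ^ (1 - γ) * φ m ^ γ / (σ - φ m)) with hf
  have hfle : ∀ m d : ℝ, ∀ k : ℕ, m = (k : ℝ) + 1 → 0 < d → d ≤ σ - φ k →
      f k ≤ A * (m ^ (-1 - δ + γ) * ((n : ℝ) + 1) ^ (1 - γ) / d) := by
    rintro _ d m rfl hd hdle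
    have hm1 : (0 : ℝ) < (m : ℝ) + 1 := by positivity
    have hnum : σ ^ (1 - γ) * φ m ^ γ ≤ A * (((n : ℝ) + 1) ^ (1 - γ) * ((m : ℝ) + 1) ^ γ) := by
      calc σ ^ (1 - γ) * φ m ^ γ
          ≤ (A * ((n : ℝ) + 1)) ^ (1 - γ) * (A * ((m : ℝ) + 1)) ^ γ :=
            mul_le_mul (Real.rpow_le_rpow hσ0.le hσle (by linarith))
              (Real.rpow_le_rpow (hpos m).le (hφle m) hγ.le)
              (Real.rpow_nonneg (hpos m).le _) (by positivity)
        _ = (A ^ (1 - γ) * A ^ γ) * (((n : ℝ) + 1) ^ (1 - γ) * ((m : ℝ) + 1) ^ γ) := by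
            rw [Real.mul_rpow hA0.le hn1.le, Real.mul_rpow hA0.le hm1.le]
            ring
        _ = _ := by rw [← Real.rpow_add hA0, sub_add_cancel, Real.rpow_one]
    calc f m ≤ ((m : ℝ) + 1) ^ (-1 - δ) *
          (A * (((n : ℝ) + 1) ^ (1 - γ) * ((m : ℝ) + 1) ^ γ) / d) := by
          refine mul_le_mul_of_nonneg_left ?_ (by positivity)
          exact div_le_div₀ (by positivity) hnum hd hdle
      _ = _ := by
          rw [Real.rpow_add hm1]
          ring
  have hfn : f n ≤ κ / 2 := by
    refine (hfle _ (E * ((n : ℝ) + 1) ^ (-δ)) n rfl hEν (by rw [hσ]; linarith)).trans ?_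
    refine le_of_eq_of_le ?_ hAE
    rw [← Real.rpow_add hn1, show -1 - δ + γ + (1 - γ) = -δ by ring]
    field_simp
  have hfhead : ∀ m ∈ Finset.range n, f m ≤ 2 * A / a * ((n : ℝ) + 1) ^ (-(γ / 2)) *
      (((m : ℝ) + 1) ^ (-1 - δ / 2) + (((n - 1 - m : ℕ) : ℝ) + 1) ^ (-1 - γ / 2)) := by
    intro m hm
    rw [Finset.mem_range] at hm
    obtain ⟨j, rfl⟩ := Nat.exists_eq_add_of_lt hm
    rw [show m + j + 1 - 1 - m = j by omega]
    have hm1 : (0 : ℝ) < (m : ℝ) + 1 := by positivity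
    have hj1 : (0 : ℝ) < (j : ℝ) + 1 := by positivity
    have hcast : (((m + j + 1 : ℕ) : ℝ) + 1) = ((m : ℝ) + 1) + ((j : ℝ) + 1) := by
      push_cast; ring
    have hgap : a / 2 * ((j : ℝ) + 1) ≤ σ - φ m := by
      have e1 := neg_le_of_abs_le (hφ (m + j + 1))
      have e2 := le_of_abs_le (hφ m)
      have e3 := mul_le_mul_of_nonneg_right hE1 hνn.le
      have e5 : 0 ≤ a * ((j : ℝ) + 1) := by positivity
      rcases le_total ((j : ℝ) + 1) ((m : ℝ) + 1) with hjm | hjm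
      · have e4 : ((m : ℝ) + 1) ^ (-δ) ≤ 2 ^ δ * (((m + j + 1 : ℕ) : ℝ) + 1) ^ (-δ) := by
          have : (2 : ℝ) ^ δ * (((m + j + 1 : ℕ) : ℝ) + 1) ^ (-δ) =
              ((((m + j + 1 : ℕ) : ℝ) + 1) / 2) ^ (-δ) := by
            rw [Real.div_rpow hn1.le (by norm_num), Real.rpow_neg (by norm_num : (0 : ℝ) ≤ 2)]
            field_simp
          rw [this]
          exact Real.rpow_le_rpow_of_nonpos (by positivity) (by rw [hcast]; linarith)
            (by linarith)
        have e6 := mul_le_mul_of_nonneg_left e4 hC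
        rw [hσ]
        nlinarith
      · have e4 := mul_le_mul_of_nonneg_left (rpow_neg_le_one hδ.le m) hC
        have e6 : 0 ≤ C * 2 ^ δ * (((m + j + 1 : ℕ) : ℝ) + 1) ^ (-δ) := by positivity
        have e7 : 4 * C ≤ a * (2 * ((j : ℝ) + 1)) := by
          refine h3.trans ?_
          rw [mul_comm]
          refine mul_le_mul_of_nonneg_left ?_ ha.le
          linarith
        rw [hσ]
        nlinarith
    refine (hfle _ _ m rfl (by positivity) hgap).trans ?_
    generalize hNdef : (((m + j + 1 : ℕ) : ℝ) + 1) = N at *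
    generalize hMdef : ((m : ℝ) + 1) = M at *
    generalize hJdef : ((j : ℝ) + 1) = J at *
    have hM1 : 1 ≤ M := by rw [← hMdef]; linarith [m.cast_nonneg (α := ℝ)]
    have hN1 : 1 ≤ N := by linarith
    have key : M ^ (-1 - δ + γ) * N ^ (1 - γ) / J =
        M ^ (-1 - δ + γ) * N ^ (-γ) + M ^ (-δ + γ) * N ^ (-γ) / J := by
      rw [show 1 - γ = -γ + 1 by ring, Real.rpow_add_one hn1.ne',
        show -δ + γ = (-1 - δ + γ) + 1 by ring, Real.rpow_add_one hm1.ne']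
      field_simp
      rw [hcast]
      ring
    have k1 : M ^ (-1 - δ + γ) * N ^ (-γ) ≤ N ^ (-(γ / 2)) * M ^ (-1 - δ / 2) := by
      rw [mul_comm]
      exact mul_le_mul (Real.rpow_le_rpow_of_exponent_le hN1 (by linarith))
        (Real.rpow_le_rpow_of_exponent_le hM1 (by linarith)) (by positivity) (by positivity)
    have k2 : M ^ (-δ + γ) * N ^ (-γ) / J ≤ N ^ (-(γ / 2)) * J ^ (-1 - γ / 2) := by
      have l1 : M ^ (-δ + γ) ≤ 1 := Real.rpow_le_one_of_one_le_of_nonpos hM1 (by linarith)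
      have l2 : N ^ (-(γ / 2)) ≤ J ^ (-(γ / 2)) :=
        Real.rpow_le_rpow_of_nonpos hj1 (by linarith) (by linarith)
      rw [show -1 - γ / 2 = -(γ / 2) - 1 by ring, Real.rpow_sub_one hj1.ne', ← mul_div_assoc,
        show -γ = -(γ / 2) + -(γ / 2) by ring, Real.rpow_add hn1]
      refine div_le_div_of_nonneg_right ?_ hj1.le
      calc M ^ (-δ + γ) * (N ^ (-(γ / 2)) * N ^ (-(γ / 2)))
          ≤ 1 * (N ^ (-(γ / 2)) * J ^ (-(γ / 2))) := by gcongr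
        _ = _ := one_mul _
    calc A * (M ^ (-1 - δ + γ) * N ^ (1 - γ) / (a / 2 * J))
        = 2 * A / a * (M ^ (-1 - δ + γ) * N ^ (1 - γ) / J) := by field_simp
      _ ≤ 2 * A / a * (N ^ (-(γ / 2)) * M ^ (-1 - δ / 2) + N ^ (-(γ / 2)) * J ^ (-1 - γ / 2)) := by
          rw [key]
          gcongr
      _ = _ := by ring
  have hhead : ∑ m ∈ Finset.range n, f m ≤ κ / 2 := by
    refine (Finset.sum_le_sum hfhead).trans ?_
    rw [← Finset.mul_sum, Finset.sum_add_distrib,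
      Finset.sum_range_reflect (fun j : ℕ => ((j : ℝ) + 1) ^ (-1 - γ / 2)) n]
    calc _ ≤ 2 * A / a * ((n : ℝ) + 1) ^ (-(γ / 2)) * (Z + Y) :=
          mul_le_mul_of_nonneg_left (add_le_add (hZ _) (hY _)) (by positivity)
      _ ≤ κ / 2 := by linarith
  rw [Finset.sum_range_succ]
  linarith

lemma HasTwoTermAsymp.exists_abs_rpow_sub_le {lam : ℕ → ℝ} {β : ℝ} (ha : 0 < a) (hδ : 0 < δ)
    (hβ : 0 < β) (hlam : HasTwoTermAsymp lam a b β δ) :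
    ∃ C : ℝ, 0 ≤ C ∧ ∀ m : ℕ,
      |lam m ^ (-β)⁻¹ - a * ((m : ℝ) + 1) - b| ≤ C * ((m : ℝ) + 1) ^ (-δ) := by
  obtain ⟨r, C, N, hr, hl⟩ := hlam
  have ev : ∀ᶠ n : ℕ in atTop, N ≤ n ∧ (|C| + |b|) / a ≤ (n : ℝ) :=
    (eventually_ge_atTop N).and (tendsto_natCast_atTop_atTop.eventually_ge_atTop _)
  obtain ⟨N', hN'⟩ := eventually_atTop.mp ev
  set e : ℕ → ℝ := fun m =>
    |lam m ^ (-β)⁻¹ - a * ((m : ℝ) + 1) - b| / ((m : ℝ) + 1) ^ (-δ) with he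
  have he0 : ∀ m, 0 ≤ e m := fun m => by positivity
  refine ⟨|C| + ∑ m ∈ Finset.range N', e m,
    add_nonneg (abs_nonneg _) (Finset.sum_nonneg fun m _ => he0 m), fun m => ?_⟩
  have hν : 0 < ((m : ℝ) + 1) ^ (-δ) := by positivity
  rw [← div_le_iff₀ hν]
  change e m ≤ _
  rcases lt_or_ge m N' with hm | hm
  · have := Finset.single_le_sum (fun i _ => he0 i) (Finset.mem_range.mpr hm)
    linarith [abs_nonneg C]
  · obtain ⟨hNm, hlarge⟩ := hN' m hm
    rw [div_le_iff₀ ha] at hlarge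
    have hrm : |r m| ≤ |C| * ((m : ℝ) + 1) ^ (-δ) :=
      (hr m hNm).trans (mul_le_mul_of_nonneg_right (le_abs_self C) hν.le)
    have hrC := hrm.trans (mul_le_of_le_one_right (abs_nonneg C) (rpow_neg_le_one hδ.le m))
    have hbase : 0 ≤ a * ((m : ℝ) + 1) + b + r m := by
      linarith [neg_abs_le b, neg_le_of_abs_le hrC]
    have hval : lam m ^ (-β)⁻¹ - a * ((m : ℝ) + 1) - b = r m := by
      rw [hl m hNm, Real.rpow_rpow_inv hbase (neg_ne_zero.mpr hβ.ne')]
      ring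
    have : e m ≤ |C| := by
      rw [he]
      simp only [hval]
      rwa [div_le_iff₀ hν]
    linarith [Finset.sum_nonneg fun i (_ : i ∈ Finset.range N') => he0 i]

end Asymptotics

/-- **Theorem 1.** Let `K`, `B` be self-adjoint compact operators on a Hilbert space `H`, with
`K` positive and `I + B` (strictly) positive. If the eigenvalues `lam n` of `K`, enumerated in
decreasing order with multiplicity with normalized eigenvectors `h n`, satisfy
`lam n = (a n + b + O(n^(-δ)))^(-B')` and `|⟪B (h n), h m⟫| ≤ c (n m)^(-(1+δ)/2)` for all `m`, `n`, then the
eigenvalues `mu n` of the generalized eigenproblem `K 𝐡 = 𝛌 (𝐡 + B 𝐡)`, enumerated in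
decreasing order with multiplicity, satisfy the same two-term asymptotics. -/
theorem theorem1_two_term_asymp_preserved
    {H : Type*} [NormedAddCommGroup H] [InnerProductSpace ℝ H] [CompleteSpace H]
    (K B : H →L[ℝ] H)
    (hKsa : IsSelfAdjoint K) (hBsa : IsSelfAdjoint B)
    (hKcomp : IsCompactOperator (⇑K)) (hBcomp : IsCompactOperator (⇑B))
    (hKpos : ∀ x : H, 0 ≤ ⟪K x, x⟫)
    (hIBpos : ∃ c₀ > (0 : ℝ), ∀ x : H, c₀ * ‖x‖ ^ 2 ≤ ⟪x + B x, x⟫)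
    (a b B' δ c : ℝ) (ha : 0 < a) (hB' : 0 < B') (hδ : 0 < δ) (hc : 0 < c)
    -- `lam` enumerates the eigenvalues of `K` in decreasing order with multiplicity;
    -- `h` is a corresponding orthonormal basis of eigenvectors
    (lam : ℕ → ℝ) (h : ℕ → H)
    (hlpos : ∀ n, 0 < lam n) (hlanti : Antitone lam)
    (heig : ∀ n, K (h n) = lam n • h n)
    (hon : Orthonormal ℝ h)
    (hcomplete : (Submodule.span ℝ (Set.range h)).topologicalClosure = ⊤)
    -- the asymptotic and perturbation hypotheses
    (hlasymp : HasTwoTermAsymp lam a b B' δ)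
    (hBh : ∀ n m, |⟪B (h n), h m⟫| ≤ c * (((n : ℝ) + 1) * ((m : ℝ) + 1)) ^ (-(1 + δ) / 2))
    -- `mu` enumerates the eigenvalues of the generalized eigenproblem `K 𝐡 = 𝛌 (𝐡 + B 𝐡)`
    -- in decreasing order with multiplicity: `g` is a complete system of generalized
    -- eigenvectors, orthonormal with respect to the inner product `⟪x + B x, y⟫`
    (mu : ℕ → ℝ) (g : ℕ → H)
    (hmpos : ∀ n, 0 < mu n) (hmanti : Antitone mu)
    (hgeig : ∀ n, K (g n) = mu n • (g n + B (g n)))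
    (hgon : ∀ n m, ⟪g n + B (g n), g m⟫ = if n = m then 1 else 0)
    (hgcomplete : (Submodule.span ℝ (Set.range g)).topologicalClosure = ⊤) :
    HasTwoTermAsymp mu a b B' δ := by
  obtain ⟨C, hC, hφ⟩ := hlasymp.exists_abs_rpow_sub_le ha hδ hB'
  have hne : -B' ≠ 0 := neg_ne_zero.mpr hB'.ne'
  have hinv : (-B')⁻¹ ≤ 0 := inv_nonpos.mpr (by linarith)
  set φ : ℕ → ℝ := fun m => lam m ^ (-B')⁻¹ with hφdef
  have hpos : ∀ m, 0 < φ m := fun m => Real.rpow_pos_of_pos (hlpos m) _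
  have hmono : Monotone φ := fun i j hij =>
    Real.rpow_le_rpow_of_nonpos (hlpos j) (hlanti hij) hinv
  have hlam : ∀ m, lam m = φ m ^ (-B') := fun m =>
    (Real.rpow_inv_rpow (hlpos m).le hne).symm
  set γ : ℝ := min 1 (min (δ / 2) B') with hγdef
  have hγ : 0 < γ := lt_min one_pos (lt_min (half_pos hδ) hB')
  have hγ1 : γ ≤ 1 := min_le_left _ _
  have hγδ : γ ≤ δ / 2 := (min_le_right _ _).trans (min_le_left _ _)
  have hγB : γ ≤ B' := (min_le_right _ _).trans (min_le_right _ _)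
  set u : ℕ → ℝ := fun m => ((m : ℝ) + 1) ^ (-(1 + δ) / 2) with hu
  have husq : ∀ m, u m ^ 2 = ((m : ℝ) + 1) ^ (-1 - δ) := fun m => by
    rw [hu, ← Real.rpow_natCast, ← Real.rpow_mul (by positivity)]
    congr 1
    push_cast
    ring
  have hBu : ∀ n m, |⟪B (h n), h m⟫| ≤ c * (u n * u m) := fun n m => by
    have := hBh n m
    rwa [Real.mul_rpow (by positivity) (by positivity)] at this
  obtain ⟨E₁, hE₁⟩ := exists_upper_sum_le ha hδ hC hmono hpos hφ (div_pos hγ hc)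
  obtain ⟨E₂, hE₂⟩ := exists_lower_sum_le ha hδ hC hpos hφ hγ hγ1 hγδ (div_pos hγ hc)
  set E := max 1 (max E₁ E₂) with hEdef
  have hE0 : 0 < E := lt_of_lt_of_le one_pos (le_max_left _ _)
  obtain ⟨N, hN⟩ := eventually_atTop.mp
    ((hE₁ E ((le_max_left _ _).trans (le_max_right _ _)) hE0).and
      (hE₂ E ((le_max_right _ _).trans (le_max_right _ _)) hE0))
  refine ⟨fun n => mu n ^ (-B')⁻¹ - a * ((n : ℝ) + 1) - b, E + C, N, fun n hn => ?_,
    fun n _ => ?_⟩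
  · obtain ⟨⟨hs0, hup⟩, hlow⟩ := hN n hn
    have hEν : 0 < E * ((n : ℝ) + 1) ^ (-δ) := by positivity
    have hge : φ n - E * ((n : ℝ) + 1) ^ (-δ) ≤ mu n ^ (-B')⁻¹ := by
      set s := φ n - E * ((n : ℝ) + 1) ^ (-δ) with hs
      have hsφ : ∀ m, n ≤ m → s < φ m := fun m hm => by linarith [hmono hm]
      have hmu : mu n ≤ s ^ (-B') := by
        refine generalized_eigenvalue_le heig hon hcomplete hc.le hBu hmanti hgeig hgon n _
          (by positivity) (fun m hm => ?_) fun S hS => ?_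
        · rw [hlam]
          exact Real.rpow_lt_rpow_of_neg hs0 (hsφ m hm) (by linarith)
        · calc s ^ (-B') * c * ∑ m ∈ S, u m ^ 2 / (s ^ (-B') - lam m)
              = c * ∑ m ∈ S, ((m : ℝ) + 1) ^ (-1 - δ) *
                (s ^ (-B') / (s ^ (-B') - φ m ^ (-B'))) := by
                rw [mul_comm _ c, mul_assoc, Finset.mul_sum]
                congr 1
                refine Finset.sum_congr rfl fun m _ => ?_
                rw [husq, ← hlam]
                ring
            _ ≤ c * ∑ m ∈ S, ((m : ℝ) + 1) ^ (-1 - δ) * (γ⁻¹ * (φ m / (φ m - s))) := by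
                refine mul_le_mul_of_nonneg_left (Finset.sum_le_sum fun m hm => ?_) hc.le
                exact mul_le_mul_of_nonneg_left
                  (rpow_neg_div_sub_le hs0 (hsφ m (hS m hm)) hγ hγ1 hγB) (by positivity)
            _ = c * γ⁻¹ * ∑ m ∈ S, ((m : ℝ) + 1) ^ (-1 - δ) * (φ m / (φ m - s)) := by
                rw [mul_assoc, Finset.mul_sum _ _ γ⁻¹]
                congr 1
                exact Finset.sum_congr rfl fun m _ => by ring
            _ ≤ c * γ⁻¹ * (γ / c) := mul_le_mul_of_nonneg_left (hup S hS) (by positivity)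
            _ = 1 := by field_simp
      have := Real.rpow_le_rpow_of_nonpos (hmpos n) hmu hinv
      rwa [Real.rpow_rpow_inv hs0.le hne] at this
    have hle : mu n ^ (-B')⁻¹ ≤ φ n + E * ((n : ℝ) + 1) ^ (-δ) := by
      set s := φ n + E * ((n : ℝ) + 1) ^ (-δ) with hs
      have hs0 : 0 < s := add_pos (hpos n) hEν
      have hsφ : ∀ m ≤ n, φ m < s := fun m hm => by linarith [hmono hm]
      have hmu : s ^ (-B') ≤ mu n := by
        refine le_generalized_eigenvalue hIBpos heig hon hc.le hBu hmanti hgeig hgon hgcomplete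
          n _ (by positivity) (fun m hm => ?_) ?_
        · rw [hlam]
          exact Real.rpow_lt_rpow_of_neg (hpos m) (hsφ m hm) (by linarith)
        · calc s ^ (-B') * c * ∑ m ∈ Finset.range (n + 1), u m ^ 2 / (lam m - s ^ (-B'))
              = c * ∑ m ∈ Finset.range (n + 1), ((m : ℝ) + 1) ^ (-1 - δ) *
                (s ^ (-B') / (φ m ^ (-B') - s ^ (-B'))) := by
                rw [mul_comm _ c, mul_assoc, Finset.mul_sum]
                congr 1
                refine Finset.sum_congr rfl fun m _ => ?_
                rw [husq, ← hlam]
                ring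
            _ ≤ c * ∑ m ∈ Finset.range (n + 1), ((m : ℝ) + 1) ^ (-1 - δ) *
                (γ⁻¹ * (s ^ (1 - γ) * φ m ^ γ / (s - φ m))) := by
                refine mul_le_mul_of_nonneg_left (Finset.sum_le_sum fun m hm => ?_) hc.le
                exact mul_le_mul_of_nonneg_left
                  (rpow_neg_div_sub_le' (hpos m)
                    (hsφ m (Nat.lt_succ_iff.mp (Finset.mem_range.mp hm))) hγ hγ1 hγB)
                  (by positivity)
            _ = c * γ⁻¹ * ∑ m ∈ Finset.range (n + 1), ((m : ℝ) + 1) ^ (-1 - δ) *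
                (s ^ (1 - γ) * φ m ^ γ / (s - φ m)) := by
                rw [mul_assoc, Finset.mul_sum _ _ γ⁻¹]
                congr 1
                exact Finset.sum_congr rfl fun m _ => by ring
            _ ≤ c * γ⁻¹ * (γ / c) := mul_le_mul_of_nonneg_left hlow (by positivity)
            _ = 1 := by field_simp
      have := Real.rpow_le_rpow_of_nonpos (by positivity) hmu hinv
      rwa [Real.rpow_rpow_inv hs0.le hne] at this
    have hφn := abs_le.mp (hφ n)
    rw [add_mul, abs_le]
    constructor <;> linarith [hφn.1, hφn.2]
  · rw [show a * ((n : ℝ) + 1) + b + (mu n ^ (-B')⁻¹ - a * ((n : ℝ) + 1) - b) =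
      mu n ^ (-B')⁻¹ by ring, Real.rpow_inv_rpow (hmpos n).le hne]
end

section
/- Let K and B be self-adjoint compact operators on a Hilbert space H, with K positive and I + B positive. Suppose the eigenvalues of K (in decreasing order with multiplicity) are organized in two interlacing sequences λ_n^{(1)} = ((2n−1)a + b_1 + O(n^{-δ}))^{-B̃} and λ_n^{(2)} = (2na + b_2 + O(n^{-δ}))^{-B̃} as n → ∞, where a, B̃, δ > 0 and b_1, b_2 ∈ ℝ, and that the corresponding normalized eigenvectors h_n satisfy ‖B h_n‖_H ≤ c n^{-(1+δ)}. Then the eigenvalues of the generalized eigenproblem K𝐡 = 𝛌(𝐡 + B𝐡), enumerated in decreasing order with multiplicity, are organized in two sequences with the same two-term asymptotics: 𝛌_n^{(1)} = ((2n−1)a + b_1 + O(n^{-δ}))^{-B̃} and 𝛌_n^{(2)} = (2na + b_2 + O(n^{-δ}))^{-B̃}. -/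
open scoped RealInnerProductSpace
open Filter

/-- The terms of the sequence `lam` are organized in two interlacing sequences
`lam^(1) n = ((2n-1) a + b₁ + O(n^(-δ)))^(-B')` and `lam^(2) n = (2n a + b₂ + O(n^(-δ)))^(-B')`
as `n → ∞`.  Here `lam` is indexed from `0`, so that `lam (2*n)` is the paper's
`lam^(1) (n+1)` (the `(2n+1)`-th term) and `lam (2*n+1)` is the paper's `lam^(2) (n+1)`
(the `(2n+2)`-th term). -/
def HasTwoSeqAsymp (lam : ℕ → ℝ) (a b₁ b₂ B' δ : ℝ) : Prop :=
  ∃ (r₁ r₂ : ℕ → ℝ) (C : ℝ) (N : ℕ),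
    (∀ n, N ≤ n → |r₁ n| ≤ C * ((n : ℝ) + 1) ^ (-δ) ∧ |r₂ n| ≤ C * ((n : ℝ) + 1) ^ (-δ)) ∧
    ∀ n, N ≤ n →
      lam (2 * n) = ((2 * (n : ℝ) + 1) * a + b₁ + r₁ n) ^ (-B') ∧
      lam (2 * n + 1) = ((2 * (n : ℝ) + 2) * a + b₂ + r₂ n) ^ (-B')

section Form

variable {H : Type*} [NormedAddCommGroup H] [InnerProductSpace ℝ H]

theorem inner_sum_smul_sum_smul {A L : H →L[ℝ] H} {f : ℕ → H} {lam : ℕ → ℝ}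
    (heig : ∀ n, L (f n) = lam n • A (f n))
    (hon : ∀ n m, ⟪A (f n), f m⟫ = if n = m then 1 else 0) (s : Finset ℕ) (c : ℕ → ℝ) :
    ⟪L (∑ k ∈ s, c k • f k), ∑ k ∈ s, c k • f k⟫ = ∑ k ∈ s, lam k * c k ^ 2 := by
  simp only [map_sum, map_smul, heig, sum_inner, inner_sum, inner_smul_left, inner_smul_right, hon]
  refine Finset.sum_congr rfl fun i hi => ?_
  simp [hi]
  ring

theorem mem_closure_span_tail (A : H →L[ℝ] H) {f : ℕ → H}
    (hon : ∀ n m, ⟪A (f n), f m⟫ = if n = m then 1 else 0)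
    (hcomplete : (Submodule.span ℝ (Set.range f)).topologicalClosure = ⊤)
    {n : ℕ} {x : H} (hx : ∀ j < n, ⟪A x, f j⟫ = 0) :
    x ∈ closure (Submodule.span ℝ (f '' Set.Ici n) : Set H) := by
  let P : H → H := fun y => y - ∑ j ∈ Finset.range n, ⟪A y, f j⟫ • f j
  have hP : Continuous P := by fun_prop
  have hPx : P x = x := by
    simp only [P]
    rw [Finset.sum_eq_zero, sub_zero]
    intro j hj
    rw [hx j (Finset.mem_range.1 hj), zero_smul]
  have hxc : x ∈ closure (Submodule.span ℝ (Set.range f) : Set H) := by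
    rw [← Submodule.topologicalClosure_coe, hcomplete]; trivial
  rw [← hPx]
  refine map_mem_closure hP hxc fun y hy => ?_
  induction hy using Submodule.span_induction with
  | mem y hy =>
    obtain ⟨k, rfl⟩ := hy
    by_cases hk : k < n
    · have : P (f k) = 0 := by simp [P, hon, hk]
      rw [this]; exact Submodule.zero_mem _
    · have : P (f k) = f k := by simp [P, hon, hk]
      rw [this]
      exact Submodule.subset_span ⟨k, not_lt.1 hk, rfl⟩
  | zero => simp [P]
  | add y z _ _ hy hz =>
    have : P (y + z) = P y + P z := by
      simp only [P, map_add, inner_add_left, add_smul, Finset.sum_add_distrib]; abel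
    rw [this]; exact Submodule.add_mem _ hy hz
  | smul r y _ hy =>
    have : P (r • y) = r • P y := by
      simp only [P, map_smul, real_inner_smul_left, mul_smul, smul_sub, Finset.smul_sum]
    rw [this]; exact Submodule.smul_mem _ _ hy

theorem exists_sum_smul_mem_closure_span_tail (A : H →L[ℝ] H) {f u : ℕ → H}
    (hon : ∀ n m, ⟪A (f n), f m⟫ = if n = m then 1 else 0)
    (hcomplete : (Submodule.span ℝ (Set.range f)).topologicalClosure = ⊤)
    (hu : LinearIndependent ℝ u) (n : ℕ) :
    ∃ c : ℕ → ℝ, ∑ k ∈ Finset.range (n + 1), c k • u k ≠ 0 ∧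
      ∑ k ∈ Finset.range (n + 1), c k • u k ∈
        closure (Submodule.span ℝ (f '' Set.Ici n) : Set H) := by
  let φ : (Fin (n + 1) → ℝ) →ₗ[ℝ] (Fin n → ℝ) :=
    LinearMap.pi fun j => ∑ i : Fin (n + 1), ⟪A (u i), f j⟫ • LinearMap.proj i
  obtain ⟨d, hd, hd0⟩ := (Submodule.ne_bot_iff _).1
    (LinearMap.ker_ne_bot_of_finrank_lt (f := φ) (by simp))
  let c : ℕ → ℝ := fun k => if hk : k < n + 1 then d ⟨k, hk⟩ else 0
  have hc : ∑ k ∈ Finset.range (n + 1), c k • u k = ∑ i : Fin (n + 1), d i • u i := by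
    rw [Finset.sum_range]
    exact Finset.sum_congr rfl fun i _ => by simp [c, Nat.lt_succ_iff.1 i.2]
  refine ⟨c, ?_, ?_⟩
  · rw [hc]
    intro h0
    refine hd0 (funext fun i => ?_)
    exact Fintype.linearIndependent_iff.1 (hu.comp _ Fin.val_injective) d h0 i
  · rw [hc]
    refine mem_closure_span_tail A hon hcomplete fun j hj => ?_
    have := congrFun (LinearMap.mem_ker.1 hd) ⟨j, hj⟩
    simp only [φ, LinearMap.pi_apply, LinearMap.sum_apply, LinearMap.smul_apply,
      LinearMap.proj_apply, Pi.zero_apply, smul_eq_mul] at this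
    simp only [map_sum, map_smul, sum_inner, real_inner_smul_left]
    rw [← this]
    exact Finset.sum_congr rfl fun i _ => mul_comm _ _

theorem abs_inner_sum_smul_le {B : H →L[ℝ] H} (hB : ∀ x y, ⟪B x, y⟫ = ⟪x, B y⟫) {h : ℕ → H}
    (hh : ∀ n, ‖h n‖ = 1) {q : ℕ → ℝ} (hq : ∀ n, ‖B (h n)‖ ≤ q n)
    {s : Finset ℕ} {w : ℕ → ℝ} (hw : ∀ k ∈ s, 0 < w k) (hqw : ∑ k ∈ s, q k / w k ≤ 1)
    (c : ℕ → ℝ) :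
    |⟪B (∑ k ∈ s, c k • h k), ∑ k ∈ s, c k • h k⟫| ≤ ∑ k ∈ s, w k * c k ^ 2 := by
  have hq0 : ∀ n, 0 ≤ q n := fun n => (norm_nonneg _).trans (hq n)
  have hentry : ∀ k l, |⟪B (h k), h l⟫| ≤ √(q k) * √(q l) := by
    intro k l
    have h1 : |⟪B (h k), h l⟫| ≤ q k := by
      simpa [hh] using (abs_real_inner_le_norm (B (h k)) (h l)).trans
        (mul_le_mul_of_nonneg_right (hq k) (norm_nonneg _))
    have h2 : |⟪B (h k), h l⟫| ≤ q l := by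
      rw [hB]
      simpa [hh] using (abs_real_inner_le_norm (h k) (B (h l))).trans
        (mul_le_mul_of_nonneg_left (hq l) (norm_nonneg _))
    rw [← Real.sqrt_mul (hq0 k)]
    apply Real.le_sqrt_of_sq_le
    rw [sq]
    exact mul_le_mul h1 h2 (abs_nonneg _) (hq0 k)
  calc |⟪B (∑ k ∈ s, c k • h k), ∑ k ∈ s, c k • h k⟫|
      = |∑ k ∈ s, ∑ l ∈ s, c k * (c l * ⟪B (h l), h k⟫)| := by
        simp only [map_sum, map_smul, sum_inner, inner_sum, real_inner_smul_left,
          real_inner_smul_right]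
    _ ≤ ∑ k ∈ s, ∑ l ∈ s, (√(q k) * |c k|) * (√(q l) * |c l|) := by
        refine (Finset.abs_sum_le_sum_abs _ _).trans (Finset.sum_le_sum fun k _ => ?_)
        refine (Finset.abs_sum_le_sum_abs _ _).trans (Finset.sum_le_sum fun l _ => ?_)
        rw [abs_mul, abs_mul]
        calc |c k| * (|c l| * |⟪B (h l), h k⟫|)
            ≤ |c k| * (|c l| * (√(q l) * √(q k))) := by gcongr; exact hentry l k
          _ = _ := by ring
    _ = (∑ k ∈ s, √(q k) * |c k|) ^ 2 := by rw [sq, Finset.sum_mul_sum]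
    _ ≤ (∑ k ∈ s, q k / w k) * ∑ k ∈ s, w k * c k ^ 2 := by
        refine Finset.sum_sq_le_sum_mul_sum_of_sq_le_mul s
          (fun k hk => div_nonneg (hq0 k) (hw k hk).le)
          (fun k hk => mul_nonneg (hw k hk).le (sq_nonneg _)) fun k hk => ?_
        rw [mul_pow, Real.sq_sqrt (hq0 k), sq_abs]
        have := (hw k hk).ne'
        apply le_of_eq
        field_simp
    _ ≤ _ := mul_le_of_le_one_left
        (Finset.sum_nonneg fun k hk => mul_nonneg (hw k hk).le (sq_nonneg _)) hqw

theorem exists_finset_sum_of_mem_span_image {f : ℕ → H} {S : Set ℕ} {x : H}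
    (hx : x ∈ Submodule.span ℝ (f '' S)) :
    ∃ (s : Finset ℕ) (c : ℕ → ℝ), (∀ k ∈ s, k ∈ S) ∧ x = ∑ k ∈ s, c k • f k := by
  obtain ⟨l, hl, rfl⟩ := (Finsupp.mem_span_image_iff_linearCombination ℝ).1 hx
  exact ⟨l.support, l, fun k hk => (Finsupp.mem_supported ℝ l).1 hl hk, rfl⟩

theorem inner_le_mul_inner_of_mem_closure_span {A L : H →L[ℝ] H} {f : ℕ → H} {S : Set ℕ} {t : ℝ}
    (hS : ∀ (s : Finset ℕ) (c : ℕ → ℝ), (∀ k ∈ s, k ∈ S) →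
      ⟪L (∑ k ∈ s, c k • f k), ∑ k ∈ s, c k • f k⟫ ≤
        t * ⟪A (∑ k ∈ s, c k • f k), ∑ k ∈ s, c k • f k⟫)
    {x : H} (hx : x ∈ closure (Submodule.span ℝ (f '' S) : Set H)) :
    ⟪L x, x⟫ ≤ t * ⟪A x, x⟫ := by
  have hcl : IsClosed {y : H | ⟪L y, y⟫ ≤ t * ⟪A y, y⟫} :=
    isClosed_le (by fun_prop) (by fun_prop)
  refine closure_minimal (fun y hy => ?_) hcl hx
  obtain ⟨s, c, hs, rfl⟩ := exists_finset_sum_of_mem_span_image hy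
  exact hS s c hs

theorem linearIndependent_of_form_orthonormal (A : H →L[ℝ] H) {f : ℕ → H}
    (hon : ∀ n m, ⟪A (f n), f m⟫ = if n = m then 1 else 0) : LinearIndependent ℝ f := by
  rw [linearIndependent_iff']
  intro s c hc i hi
  have : ⟪A (∑ k ∈ s, c k • f k), f i⟫ = c i := by
    simp [map_sum, sum_inner, real_inner_smul_left, hon, hi]
  rw [← this, hc, map_zero, inner_zero_left]

section Comparison

variable {K B : H →L[ℝ] H} (hB : ∀ x y, ⟪B x, y⟫ = ⟪x, B y⟫)
  (hpos : ∀ x : H, x ≠ 0 → 0 < ⟪x + B x, x⟫)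
  {lam : ℕ → ℝ} {h : ℕ → H} (hlpos : ∀ n, 0 < lam n)
  (heig : ∀ n, K (h n) = lam n • h n) (hon : Orthonormal ℝ h)
  (hcomplete : (Submodule.span ℝ (Set.range h)).topologicalClosure = ⊤)
  {mu : ℕ → ℝ} {g : ℕ → H} (hmanti : Antitone mu)
  (hgeig : ∀ n, K (g n) = mu n • (g n + B (g n)))
  (hgon : ∀ n m, ⟪g n + B (g n), g m⟫ = if n = m then 1 else 0)
  (hgcomplete : (Submodule.span ℝ (Set.range g)).topologicalClosure = ⊤)
  {q : ℕ → ℝ} (hq : ∀ n, ‖B (h n)‖ ≤ q n)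

include hB hpos hlpos heig hon hcomplete hmanti hgeig hgon hq in
theorem mul_genEigenvalue_le {n : ℕ} {ε : ℝ} (hε : ε < 1) {w : ℕ → ℝ}
    (hw : ∀ k, n ≤ k → 0 < w k) (hwl : ∀ k, n ≤ k → w k ≤ 1 - (1 - ε) * (lam k / lam n))
    (hqw : ∀ s : Finset ℕ, (∀ k ∈ s, n ≤ k) → ∑ k ∈ s, q k / w k ≤ 1) :
    (1 - ε) * mu n ≤ lam n := by
  have hon' : ∀ n m, ⟪ContinuousLinearMap.id ℝ H (h n), h m⟫ = if n = m then 1 else 0 :=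
    orthonormal_iff_ite.1 hon
  have hgeig' : ∀ n, K (g n) = mu n • (ContinuousLinearMap.id ℝ H + B) (g n) := hgeig
  have hgon' : ∀ n m, ⟪(ContinuousLinearMap.id ℝ H + B) (g n), g m⟫ = if n = m then 1 else 0 :=
    hgon
  have hposA : ∀ x : H, x ≠ 0 → 0 < ⟪(ContinuousLinearMap.id ℝ H + B) x, x⟫ := hpos
  obtain ⟨c, hc0, hc⟩ := exists_sum_smul_mem_closure_span_tail _ hon' hcomplete
    (linearIndependent_of_form_orthonormal _ hgon') n
  have h1ε : 0 < 1 - ε := by linarith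
  have hup := inner_le_mul_inner_of_mem_closure_span (L := K) (A := ContinuousLinearMap.id ℝ H + B)
    (t := lam n / (1 - ε)) (fun s d hs => ?_) hc
  · rw [inner_sum_smul_sum_smul hgeig' hgon'] at hup
    have hpos' := hposA _ hc0
    have hsq := inner_sum_smul_sum_smul (L := ContinuousLinearMap.id ℝ H + B) (lam := fun _ => 1)
      (by simp) hgon' (Finset.range (n + 1)) c
    simp only [one_mul] at hsq
    rw [hsq] at hup
    rw [hsq] at hpos'
    have : mu n * ∑ k ∈ Finset.range (n + 1), c k ^ 2 ≤
        ∑ k ∈ Finset.range (n + 1), mu k * c k ^ 2 := by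
      rw [Finset.mul_sum]
      refine Finset.sum_le_sum fun k hk => ?_
      gcongr
      exact hmanti (Nat.lt_succ_iff.1 (Finset.mem_range.1 hk))
    have := le_of_mul_le_mul_right (this.trans hup) hpos'
    rw [le_div_iff₀ h1ε] at this
    linarith
  · have hb := abs_inner_sum_smul_le hB hon.1 hq (fun k hk => hw k (hs k hk)) (hqw s hs) d
    have hsq := inner_sum_smul_sum_smul (L := ContinuousLinearMap.id ℝ H) (lam := fun _ => 1)
      (by simp) hon' s d
    rw [inner_sum_smul_sum_smul (A := ContinuousLinearMap.id ℝ H) heig hon', add_apply,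
      inner_add_left, hsq]
    have hl := hlpos n
    have : ∑ k ∈ s, w k * d k ^ 2 ≤ ∑ k ∈ s, (1 - (1 - ε) * (lam k / lam n)) * d k ^ 2 :=
      Finset.sum_le_sum fun k hk => mul_le_mul_of_nonneg_right (hwl k (hs k hk)) (sq_nonneg _)
    have h2 : ∑ k ∈ s, (1 - (1 - ε) * (lam k / lam n)) * d k ^ 2 =
        ∑ k ∈ s, 1 * d k ^ 2 - (1 - ε) / lam n * ∑ k ∈ s, lam k * d k ^ 2 := by
      rw [Finset.mul_sum, ← Finset.sum_sub_distrib]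
      exact Finset.sum_congr rfl fun k _ => by ring
    have h3 := (abs_le.1 hb).1
    have h4 : (1 - ε) / lam n * ∑ k ∈ s, lam k * d k ^ 2 ≤ ∑ k ∈ s, 1 * d k ^ 2 +
        ⟪B (∑ k ∈ s, d k • h k), ∑ k ∈ s, d k • h k⟫ := by linarith
    calc ∑ k ∈ s, lam k * d k ^ 2
        = lam n / (1 - ε) * ((1 - ε) / lam n * ∑ k ∈ s, lam k * d k ^ 2) := by field_simp
      _ ≤ _ := mul_le_mul_of_nonneg_left h4 (by positivity)

include hB hpos hlpos heig hon hmanti hgeig hgon hgcomplete hq in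
theorem le_mul_genEigenvalue {n : ℕ} {ε : ℝ} (hε : 0 < ε) {w : ℕ → ℝ}
    (hw : ∀ k, k ≤ n → 0 < w k) (hwl : ∀ k, k ≤ n → w k ≤ (1 + ε) * (lam k / lam n) - 1)
    (hqw : ∑ k ∈ Finset.range (n + 1), q k / w k ≤ 1) :
    lam n ≤ (1 + ε) * mu n := by
  have hon' : ∀ n m, ⟪ContinuousLinearMap.id ℝ H (h n), h m⟫ = if n = m then 1 else 0 :=
    orthonormal_iff_ite.1 hon
  have hgeig' : ∀ n, K (g n) = mu n • (ContinuousLinearMap.id ℝ H + B) (g n) := hgeig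
  have hgon' : ∀ n m, ⟪(ContinuousLinearMap.id ℝ H + B) (g n), g m⟫ = if n = m then 1 else 0 :=
    hgon
  have hposA : ∀ x : H, x ≠ 0 → 0 < ⟪(ContinuousLinearMap.id ℝ H + B) x, x⟫ := hpos
  obtain ⟨d, hd0, hd⟩ := exists_sum_smul_mem_closure_span_tail _ hgon' hgcomplete
    (linearIndependent_of_form_orthonormal _ hon') n
  have h1ε : 0 < 1 + ε := by linarith
  have hl := hlpos n
  have hup := inner_le_mul_inner_of_mem_closure_span (L := K) (A := ContinuousLinearMap.id ℝ H + B)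
    (t := mu n) (fun s c hs => ?_) hd
  · have hk : ∀ k ∈ Finset.range (n + 1), k ≤ n := fun k hk =>
      Nat.lt_succ_iff.1 (Finset.mem_range.1 hk)
    have hb := abs_inner_sum_smul_le hB hon.1 hq (fun k hk' => hw k (hk k hk')) hqw d
    have hsq := inner_sum_smul_sum_smul (L := ContinuousLinearMap.id ℝ H) (lam := fun _ => 1)
      (by simp) hon' (Finset.range (n + 1)) d
    have hpos' := hposA _ hd0
    rw [inner_sum_smul_sum_smul (A := ContinuousLinearMap.id ℝ H) heig hon'] at hup
    have : ∑ k ∈ Finset.range (n + 1), w k * d k ^ 2 ≤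
        ∑ k ∈ Finset.range (n + 1), ((1 + ε) * (lam k / lam n) - 1) * d k ^ 2 :=
      Finset.sum_le_sum fun k hk' => mul_le_mul_of_nonneg_right (hwl k (hk k hk')) (sq_nonneg _)
    have h2 : ∑ k ∈ Finset.range (n + 1), ((1 + ε) * (lam k / lam n) - 1) * d k ^ 2 =
        (1 + ε) / lam n * ∑ k ∈ Finset.range (n + 1), lam k * d k ^ 2 -
          ∑ k ∈ Finset.range (n + 1), 1 * d k ^ 2 := by
      rw [Finset.mul_sum, ← Finset.sum_sub_distrib]
      exact Finset.sum_congr rfl fun k _ => by ring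
    have h3 := (abs_le.1 hb).2
    have h4 : ⟪(ContinuousLinearMap.id ℝ H + B) (∑ k ∈ Finset.range (n + 1), d k • h k),
        ∑ k ∈ Finset.range (n + 1), d k • h k⟫ ≤
          (1 + ε) / lam n * ∑ k ∈ Finset.range (n + 1), lam k * d k ^ 2 := by
      rw [add_apply, inner_add_left, hsq]
      linarith
    have h5 := h4.trans (mul_le_mul_of_nonneg_left hup (by positivity))
    rw [← mul_assoc] at h5
    have h6 := le_of_mul_le_mul_right ((one_mul _).trans_le h5) hpos'
    rwa [div_mul_eq_mul_div, le_div_iff₀ hl, one_mul] at h6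
  · have hsq := inner_sum_smul_sum_smul (L := ContinuousLinearMap.id ℝ H + B) (lam := fun _ => 1)
      (by simp) hgon' s c
    rw [inner_sum_smul_sum_smul hgeig' hgon', hsq, Finset.mul_sum]
    refine Finset.sum_le_sum fun k hk => ?_
    rw [one_mul]
    gcongr
    exact hmanti (hs k hk)

end Comparison

end Form

theorem min_one_mul_one_sub_le_one_sub_rpow {x p : ℝ} (hx : 0 < x) (hx1 : x ≤ 1) (hp : 0 < p) :
    min 1 p * (1 - x) ≤ 1 - x ^ p := by
  rcases le_total 1 p with h | h
  · have := Real.rpow_le_rpow_of_exponent_ge hx hx1 h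
    rw [Real.rpow_one] at this
    rw [min_eq_left h]
    linarith
  · have := rpow_one_add_le_one_add_mul_self (s := x - 1) (by linarith) hp.le h
    rw [add_sub_cancel] at this
    rw [min_eq_right h]
    linarith

theorem sum_le_of_le_ite_add {p : ℝ} (hp : 1 < p) {s : Finset ℕ} {φ : ℕ → ℕ}
    (hφ : Set.InjOn φ s) {J : ℕ} {D R : ℝ} (hD : 0 ≤ D) (hR : 0 ≤ R) {f : ℕ → ℝ}
    (hf : ∀ k ∈ s, f k ≤ (if φ k < J then D else 0) +
      R * ((φ k : ℝ) ^ (-p) + ((k + 1 : ℕ) : ℝ) ^ (-p))) :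
    ∑ k ∈ s, f k ≤ J * D + R * (2 * ∑' j : ℕ, (j : ℝ) ^ (-p)) := by
  have hsum : Summable fun j : ℕ => (j : ℝ) ^ (-p) := Real.summable_nat_rpow.2 (by linarith)
  have hle : ∀ ψ : ℕ → ℕ, Set.InjOn ψ s → ∑ k ∈ s, (ψ k : ℝ) ^ (-p) ≤ ∑' j : ℕ, (j : ℝ) ^ (-p) := by
    intro ψ hψ
    rw [← Finset.sum_image (f := fun j : ℕ => (j : ℝ) ^ (-p)) hψ]
    exact hsum.sum_le_tsum _ fun j _ => by positivity
  have hnear : ∑ k ∈ s, (if φ k < J then D else 0) ≤ J * D := by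
    rw [← Finset.sum_image (f := fun j : ℕ => if j < J then D else 0) hφ, ← Finset.sum_filter,
      Finset.sum_const, nsmul_eq_mul]
    gcongr
    calc _ ≤ (Finset.range J).card := Finset.card_le_card fun j hj => by simp at hj ⊢; exact hj.2
      _ = J := Finset.card_range J
  calc ∑ k ∈ s, f k ≤ _ := Finset.sum_le_sum hf
    _ = ∑ k ∈ s, (if φ k < J then D else 0) +
        R * (∑ k ∈ s, (φ k : ℝ) ^ (-p) + ∑ k ∈ s, ((k + 1 : ℕ) : ℝ) ^ (-p)) := by
      rw [Finset.sum_add_distrib, ← Finset.mul_sum, Finset.sum_add_distrib]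
    _ ≤ _ := by
      have h1 := hle φ hφ
      have h2 := hle (· + 1) (fun _ _ _ _ h => Nat.succ_injective h)
      rw [two_mul]
      gcongr

theorem rpow_neg_div_le {X Y T β δ : ℝ} (hX : 1 ≤ X) (hY : 1 ≤ Y) (hT : 1 ≤ T) (hTX : T ≤ X)
    (hYX : Y ≤ X) (hβ : 0 < β) (hβδ : β ≤ δ) :
    X ^ (-δ) / Y ≤ T ^ (-(β / 2)) * Y ^ (-(1 + β / 2)) := by
  have hX0 : 0 < X := by linarith
  have hY0 : 0 < Y := by linarith
  have hT0 : 0 < T := by linarith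
  calc X ^ (-δ) / Y ≤ X ^ (-β) / Y := by
        gcongr
    _ = X ^ (-(β / 2)) * X ^ (-(β / 2)) / Y := by rw [← Real.rpow_add hX0]; congr 2; ring
    _ ≤ T ^ (-(β / 2)) * Y ^ (-(β / 2)) / Y := by
        have h1 : X ^ (-(β / 2)) ≤ T ^ (-(β / 2)) :=
          Real.rpow_le_rpow_of_nonpos hT0 hTX (by linarith)
        have h2 : X ^ (-(β / 2)) ≤ Y ^ (-(β / 2)) :=
          Real.rpow_le_rpow_of_nonpos hY0 hYX (by linarith)
        gcongr
    _ = _ := by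
        rw [show -(1 + β / 2) = -(β / 2) - 1 by ring, Real.rpow_sub_one hY0.ne', mul_div_assoc]

theorem rpow_mul_add_div_le {X Y β δ : ℝ} (hX : 1 ≤ X) (hY : 1 ≤ Y) (hβ : 0 < β)
    (hβδ : 2 * β ≤ δ) :
    X ^ (-1 - δ + β) * (X + Y) ^ (-β) * ((X + Y) / Y) ≤
      (X + Y) ^ (-(β / 2)) * (Y ^ (-(1 + β / 2)) + X ^ (-(1 + β / 2))) := by
  have hX0 : 0 < X := by linarith
  have hY0 : 0 < Y := by linarith
  have hT0 : 0 < X + Y := by linarith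
  have h1 : X ^ (-1 - δ + β) ≤ X ^ (-(1 + β)) := Real.rpow_le_rpow_of_exponent_le hX (by linarith)
  have h2 : X ^ (-(1 + β)) ≤ X ^ (-(1 + β / 2)) :=
    Real.rpow_le_rpow_of_exponent_le hX (by linarith)
  have h3 : X ^ (-(1 + β)) * X = X ^ (-β) := by
    rw [← Real.rpow_add_one hX0.ne']; congr 1; ring
  have h4 : X ^ (-β) ≤ 1 := Real.rpow_le_one_of_one_le_of_nonpos hX (by linarith)
  have h5 : (X + Y) ^ (-β) = (X + Y) ^ (-(β / 2)) * (X + Y) ^ (-(β / 2)) := by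
    rw [← Real.rpow_add hT0]; congr 1; ring
  have h6 : (X + Y) ^ (-(β / 2)) ≤ Y ^ (-(β / 2)) :=
    Real.rpow_le_rpow_of_nonpos hY0 (by linarith) (by linarith)
  have h7 : (X + Y) ^ (-(β / 2)) ≤ 1 :=
    Real.rpow_le_one_of_one_le_of_nonpos (by linarith) (by linarith)
  have h8 : Y ^ (-(β / 2)) / Y = Y ^ (-(1 + β / 2)) := by
    rw [show -(1 + β / 2) = -(β / 2) - 1 by ring, Real.rpow_sub_one hY0.ne']
  calc X ^ (-1 - δ + β) * (X + Y) ^ (-β) * ((X + Y) / Y)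
      ≤ X ^ (-(1 + β)) * (X + Y) ^ (-β) * ((X + Y) / Y) := by gcongr
    _ = (X + Y) ^ (-(β / 2)) * ((X + Y) ^ (-(β / 2)) * (X ^ (-(1 + β)) * X) / Y +
          (X + Y) ^ (-(β / 2)) * X ^ (-(1 + β))) := by rw [h5]; field_simp
    _ ≤ (X + Y) ^ (-(β / 2)) * (Y ^ (-(β / 2)) * 1 / Y + 1 * X ^ (-(1 + β / 2))) := by
        rw [h3]
        gcongr
    _ = _ := by rw [mul_one, one_mul, h8]

section Gap

variable {ν : ℕ → ℝ} {a C₀ : ℝ} (ha : 0 < a) (hν0 : ∀ k, 0 < ν k)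
  (hν : ∀ k : ℕ, |ν k - a * ((k : ℝ) + 1)| ≤ C₀)

include ha hν in
theorem half_mul_le_sub {J k n : ℕ} (hJ : 4 * C₀ ≤ a * J) (hkn : n + J ≤ k) :
    a / 2 * ((k : ℝ) - n) ≤ ν k - ν n := by
  have h1 := (abs_le.1 (hν k)).1
  have h2 := (abs_le.1 (hν n)).2
  have h3 : (n : ℝ) + J ≤ k := by exact_mod_cast hkn
  nlinarith

include hν in
theorem le_add_mul_succ (k : ℕ) : ν k ≤ (a + C₀) * ((k : ℝ) + 1) := by
  have h1 := (abs_le.1 (hν k)).2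
  have h0 : 0 ≤ C₀ := (abs_nonneg _).trans (hν 0)
  have : (0 : ℝ) ≤ k := Nat.cast_nonneg k
  nlinarith

include ha hν0 hν in
theorem relative_gap_le {p : ℝ} (hp : 0 < p) {J k n : ℕ} (hJ : 4 * C₀ ≤ a * J)
    (hkn : n + J ≤ k) :
    min 1 p * (a / 2 / (a + C₀)) * (((k : ℝ) - n) / (k + 1)) ≤ 1 - (ν n / ν k) ^ p := by
  have h0 : 0 ≤ C₀ := (abs_nonneg _).trans (hν 0)
  have h1 := half_mul_le_sub ha hν hJ hkn
  have h2 : (0 : ℝ) ≤ (k : ℝ) - n := by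
    have : n ≤ k := by omega
    have : (n : ℝ) ≤ k := by exact_mod_cast this
    linarith
  have h3 : ν n ≤ ν k := by nlinarith
  refine le_trans ?_ (min_one_mul_one_sub_le_one_sub_rpow (div_pos (hν0 n) (hν0 k))
    ((div_le_one (hν0 k)).2 h3) hp)
  rw [mul_assoc]
  refine mul_le_mul_of_nonneg_left ?_ (by positivity)
  rw [one_sub_div (hν0 k).ne', div_mul_div_comm]
  exact div_le_div₀ (by linarith) h1 (hν0 k) (le_add_mul_succ hν k)

variable {p δ β C M : ℝ} (hp : 0 < p) (hC : 0 < C) (hM : 0 < M) {J : ℕ} (hJ1 : 1 ≤ J)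
  (hJ : 4 * C₀ ≤ a * J)

include hC hM in
theorem near_term_le (hδ : 0 < δ) {k n : ℕ} (hkn : n < k + J) :
    C * ((k : ℝ) + 1) ^ (-(1 + δ)) / (M * ((n : ℝ) + 1) ^ (-(1 + δ))) ≤
      C * ((J : ℝ) + 1) ^ (1 + δ) / M := by
  have hn : (n : ℝ) + 1 ≤ (J + 1) * (k + 1) := by
    have : n + 1 ≤ (J + 1) * (k + 1) := by nlinarith
    exact_mod_cast this
  have hk0 : (0 : ℝ) < (k : ℝ) + 1 := by positivity
  have hn0 : (0 : ℝ) < (n : ℝ) + 1 := by positivity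
  have h := Real.rpow_le_rpow hn0.le hn (z := 1 + δ) (by linarith)
  rw [Real.mul_rpow (by positivity) hk0.le] at h
  rw [Real.rpow_neg hk0.le, Real.rpow_neg hn0.le]
  have h1 : 0 < ((k : ℝ) + 1) ^ (1 + δ) := by positivity
  have h2 : 0 < ((n : ℝ) + 1) ^ (1 + δ) := by positivity
  rw [show C * (((k : ℝ) + 1) ^ (1 + δ))⁻¹ / (M * (((n : ℝ) + 1) ^ (1 + δ))⁻¹) =
    C / M * (((n : ℝ) + 1) ^ (1 + δ) / ((k : ℝ) + 1) ^ (1 + δ)) by field_simp,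
    mul_div_right_comm]
  gcongr
  rwa [div_le_iff₀ h1]

include ha hν0 hν hp hC hJ1 hJ in
theorem far_term_above_le (hβ : 0 < β) (hβδ : β ≤ δ) {k n : ℕ} (hkn : n + J ≤ k) {w : ℝ}
    (hw : 1 - (ν n / ν k) ^ p ≤ w) :
    C * ((k : ℝ) + 1) ^ (-(1 + δ)) / w ≤ C / (min 1 p * (a / 2 / (a + C₀))) *
      (((n : ℝ) + 1) ^ (-(β / 2)) * ((k : ℝ) - n) ^ (-(1 + β / 2))) := by
  have h0 : 0 ≤ C₀ := (abs_nonneg _).trans (hν 0)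
  have hY : (1 : ℝ) ≤ (k : ℝ) - n := by
    have : n + 1 ≤ k := by omega
    have : (n : ℝ) + 1 ≤ k := by exact_mod_cast this
    linarith
  have hn : (0 : ℝ) ≤ n := Nat.cast_nonneg n
  have hX : (0 : ℝ) < (k : ℝ) + 1 := by positivity
  have hg := (relative_gap_le ha hν0 hν hp hJ hkn).trans hw
  have hm : 0 < min 1 p * (a / 2 / (a + C₀)) := by positivity
  have hY0 : (0 : ℝ) < (k : ℝ) - n := by linarith
  calc C * ((k : ℝ) + 1) ^ (-(1 + δ)) / w
      ≤ C * ((k : ℝ) + 1) ^ (-(1 + δ)) /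
        (min 1 p * (a / 2 / (a + C₀)) * (((k : ℝ) - n) / (k + 1))) := by gcongr
    _ = C / (min 1 p * (a / 2 / (a + C₀))) * (((k : ℝ) + 1) ^ (-δ) / ((k : ℝ) - n)) := by
        rw [show -(1 + δ) = -δ - 1 by ring, Real.rpow_sub_one hX.ne']
        field_simp
    _ ≤ _ := by
        gcongr
        exact rpow_neg_div_le (by linarith) hY (by linarith) (by linarith) (by linarith) hβ hβδ

include ha hν0 hν hp hC hJ1 hJ in
theorem far_term_below_le (hβ : 0 < β) (hβδ : 2 * β ≤ δ) (hβp : β ≤ p) {k n : ℕ}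
    (hkn : k + J ≤ n) {w : ℝ} (hw : (ν n / ν k) ^ p - 1 ≤ w) :
    C * ((k : ℝ) + 1) ^ (-(1 + δ)) / w ≤
      C / ((a / 2 / (a + C₀)) ^ β * (min 1 p * (a / 2 / (a + C₀)))) *
      (((n : ℝ) + 1) ^ (-(β / 2)) *
        (((n : ℝ) - k) ^ (-(1 + β / 2)) + ((k : ℝ) + 1) ^ (-(1 + β / 2)))) := by
  have h0 : 0 ≤ C₀ := (abs_nonneg _).trans (hν 0)
  have hY : (1 : ℝ) ≤ (n : ℝ) - k := by
    have : k + 1 ≤ n := by omega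
    have : (k : ℝ) + 1 ≤ n := by exact_mod_cast this
    linarith
  have hk : (0 : ℝ) ≤ k := Nat.cast_nonneg k
  have hX : (0 : ℝ) < (k : ℝ) + 1 := by positivity
  have hT : (0 : ℝ) < (n : ℝ) + 1 := by positivity
  have hY0 : (0 : ℝ) < (n : ℝ) - k := by linarith
  have hm : 0 < min 1 p * (a / 2 / (a + C₀)) := by positivity
  set κ := a / 2 / (a + C₀) with hκ
  have hκ0 : 0 < κ := by positivity
  have hg := relative_gap_le ha hν0 hν hp hJ hkn
  have hs1 : 1 ≤ ν n / ν k := by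
    rw [one_le_div (hν0 k)]
    nlinarith [half_mul_le_sub ha hν hJ hkn]
  have hs : κ * (((n : ℝ) + 1) / (k + 1)) ≤ ν n / ν k := by
    rw [hκ, div_mul_div_comm]
    refine div_le_div₀ (hν0 n).le ?_ (hν0 k) (le_add_mul_succ hν k)
    have h1 := (abs_le.1 (hν n)).1
    have h2 : (J : ℝ) ≤ n := by exact_mod_cast (by omega : J ≤ n)
    nlinarith
  have ht : κ ^ β * (((n : ℝ) + 1) ^ β / ((k : ℝ) + 1) ^ β) ≤ (ν n / ν k) ^ p := by
    rw [← Real.div_rpow hT.le hX.le, ← Real.mul_rpow hκ0.le (by positivity)]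
    exact (Real.rpow_le_rpow (by positivity) hs hβ.le).trans
      (Real.rpow_le_rpow_of_exponent_le hs1 hβp)
  have hsplit : (ν n / ν k) ^ p - 1 = (ν n / ν k) ^ p * (1 - (ν k / ν n) ^ p) := by
    rw [mul_sub, mul_one, ← Real.mul_rpow (by have := hν0 n; have := hν0 k; positivity)
      (by have := hν0 n; have := hν0 k; positivity), div_mul_div_cancel₀ (hν0 k).ne',
      div_self (hν0 n).ne', Real.one_rpow]
  have hw' : κ ^ β * (((n : ℝ) + 1) ^ β / ((k : ℝ) + 1) ^ β) *
      (min 1 p * κ * (((n : ℝ) - k) / (n + 1))) ≤ w := by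
    refine le_trans ?_ hw
    rw [hsplit]
    have : 0 ≤ (ν n / ν k) ^ p := by linarith [Real.one_le_rpow hs1 hp.le]
    gcongr
  calc C * ((k : ℝ) + 1) ^ (-(1 + δ)) / w
      ≤ C * ((k : ℝ) + 1) ^ (-(1 + δ)) / (κ ^ β * (((n : ℝ) + 1) ^ β / ((k : ℝ) + 1) ^ β) *
      (min 1 p * κ * (((n : ℝ) - k) / (n + 1)))) := by gcongr
    _ = C / (κ ^ β * (min 1 p * κ)) * (((k : ℝ) + 1) ^ (-1 - δ + β) *
        ((k : ℝ) + 1 + ((n : ℝ) - k)) ^ (-β) *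
          (((k : ℝ) + 1 + ((n : ℝ) - k)) / ((n : ℝ) - k))) := by
        rw [show (k : ℝ) + 1 + ((n : ℝ) - k) = n + 1 by ring, show -1 - δ + β = -(1 + δ) + β by ring,
          Real.rpow_add hX, Real.rpow_neg hT.le β]
        field_simp
    _ ≤ _ := by
        have := rpow_mul_add_div_le (X := (k : ℝ) + 1) (Y := (n : ℝ) - k) (by linarith) hY hβ hβδ
        rw [show (k : ℝ) + 1 + ((n : ℝ) - k) = n + 1 by ring] at this ⊢
        gcongr

include ha hν0 hν hp hC in
theorem exists_eventually_sum_div_le_one (hδ : 0 < δ) :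
    ∃ M > 0, ∀ᶠ n : ℕ in atTop,
      (∀ w : ℕ → ℝ, (∀ k, n ≤ k → M * ((n : ℝ) + 1) ^ (-(1 + δ)) ≤ w k ∧
          1 - (ν n / ν k) ^ p ≤ w k) →
        ∀ s : Finset ℕ, (∀ k ∈ s, n ≤ k) → ∑ k ∈ s, C * ((k : ℝ) + 1) ^ (-(1 + δ)) / w k ≤ 1) ∧
      (∀ w : ℕ → ℝ, (∀ k, k ≤ n → M * ((n : ℝ) + 1) ^ (-(1 + δ)) ≤ w k ∧
          (ν n / ν k) ^ p - 1 ≤ w k) →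
        ∑ k ∈ Finset.range (n + 1), C * ((k : ℝ) + 1) ^ (-(1 + δ)) / w k ≤ 1) := by
  have h0 : 0 ≤ C₀ := (abs_nonneg _).trans (hν 0)
  obtain ⟨J, hJ'⟩ := exists_nat_ge (max 1 (4 * C₀ / a))
  have hJ1 : 1 ≤ J := by exact_mod_cast (le_max_left _ _).trans hJ'
  have hJ : 4 * C₀ ≤ a * J := by
    have := (le_max_right _ _).trans hJ'
    rwa [div_le_iff₀ ha, mul_comm (J : ℝ)] at this
  have hJ0 : (0 : ℝ) < J := by exact_mod_cast hJ1
  set β := min p (δ / 2)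
  have hβ : 0 < β := lt_min hp (by linarith)
  have hβp : β ≤ p := min_le_left _ _
  have hβδ : 2 * β ≤ δ := by linarith [min_le_right p (δ / 2)]
  set κ := a / 2 / (a + C₀)
  have hκ : 0 < κ := by positivity
  set R₁ := C / (min 1 p * κ)
  have hR₁ : 0 < R₁ := by positivity
  set R₂ := C / (κ ^ β * (min 1 p * κ))
  have hR₂ : 0 < R₂ := by positivity
  set D := C * ((J : ℝ) + 1) ^ (1 + δ)
  have hD : 0 < D := by positivity
  have hM : 0 < 2 * J * D := by positivity
  have hJD : J * (D / (2 * J * D)) = 1 / 2 := by field_simp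
  set Z := ∑' j : ℕ, (j : ℝ) ^ (-(1 + β / 2))
  have htend : Tendsto (fun n : ℕ => (R₁ + R₂) * ((n : ℝ) + 1) ^ (-(β / 2)) * (2 * Z)) atTop
      (nhds ((R₁ + R₂) * 0 * (2 * Z))) := by
    refine Tendsto.mul_const _ (Tendsto.const_mul _ ?_)
    exact (tendsto_rpow_neg_atTop (by linarith)).comp
      (tendsto_atTop_add_const_right _ _ tendsto_natCast_atTop_atTop)
  have hev : ∀ᶠ n : ℕ in atTop, (R₁ + R₂) * ((n : ℝ) + 1) ^ (-(β / 2)) * (2 * Z) ≤ 1 / 2 :=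
    htend.eventually_le_const (by norm_num)
  refine ⟨2 * J * D, hM, hev.mono fun n hn => ⟨fun w hw s hs => ?_, fun w hw => ?_⟩⟩
  · refine (sum_le_of_le_ite_add (p := 1 + β / 2) (φ := fun k => k - n) (J := J)
      (D := D / (2 * J * D)) (R := (R₁ + R₂) * ((n : ℝ) + 1) ^ (-(β / 2)))
      (by linarith) ?_ (by positivity) (by positivity) fun k hk => ?_).trans (b := _) ?_
    · intro k hk l hl hkl
      have := hs k hk
      have := hs l hl
      simp only at hkl
      omega
    · have hkn := hs k hk
      split_ifs with hc
      · refine (div_le_div_of_nonneg_left (by positivity) (by positivity) (hw k hkn).1).trans ?_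
        refine (near_term_le hC hM (J := J) hδ (by omega)).trans ?_
        exact le_add_of_nonneg_right (by positivity)
      · refine (far_term_above_le ha hν0 hν hp hC hJ1 hJ hβ (by linarith) (by omega)
          (hw k hkn).2).trans ?_
        rw [zero_add, Nat.cast_sub hkn, ← mul_assoc]
        have : (0 : ℝ) ≤ (k : ℝ) - n := sub_nonneg.2 (by exact_mod_cast hkn)
        gcongr
        · exact le_add_of_nonneg_right hR₂.le
        · exact le_add_of_nonneg_right (by positivity)
    · rw [hJD]; linarith
  · refine (sum_le_of_le_ite_add (p := 1 + β / 2) (φ := fun k => n - k) (J := J)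
      (D := D / (2 * J * D)) (R := (R₁ + R₂) * ((n : ℝ) + 1) ^ (-(β / 2)))
      (by linarith) ?_ (by positivity) (by positivity) fun k hk => ?_).trans (b := _) ?_
    · intro k hk l hl hkl
      simp only [Finset.coe_range, Set.mem_Iio] at hk hl hkl
      omega
    · have hkn : k ≤ n := Nat.lt_succ_iff.1 (Finset.mem_range.1 hk)
      split_ifs with hc
      · refine (div_le_div_of_nonneg_left (by positivity) (by positivity) (hw k hkn).1).trans ?_
        refine (near_term_le hC hM (J := J) hδ (by omega)).trans ?_
        exact le_add_of_nonneg_right (by positivity)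
      · refine (far_term_below_le ha hν0 hν hp hC hJ1 hJ hβ hβδ hβp (by omega)
          (hw k hkn).2).trans ?_
        have : (0 : ℝ) ≤ (n : ℝ) - k := sub_nonneg.2 (by exact_mod_cast hkn)
        rw [zero_add, Nat.cast_sub hkn, ← mul_assoc, Nat.cast_succ]
        gcongr
        exact le_add_of_nonneg_left hR₁.le
    · rw [hJD]; linarith

end Gap

theorem exists_forall_le_of_eventually_le {u : ℕ → ℝ} {b : ℝ} (hu : ∀ᶠ n in atTop, u n ≤ b) :
    ∃ C > 0, ∀ n, u n ≤ C := by
  obtain ⟨C, hC⟩ := IsBoundedUnder.bddAbove_range (f := u) ⟨b, hu⟩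
  exact ⟨max C 1, by positivity, fun n => (hC ⟨n, rfl⟩).trans (le_max_left _ _)⟩

theorem HasTwoSeqAsymp.exists_remainder {lam : ℕ → ℝ} {a b₁ b₂ B' δ : ℝ}
    (hl : HasTwoSeqAsymp lam a b₁ b₂ B' δ) (ha : 0 < a) (hB' : 0 < B') (hδ : 0 < δ) :
    ∃ (C : ℝ) (N : ℕ), ∀ n, N ≤ n →
      |lam (2 * n) ^ (-B'⁻¹) - ((2 * (n : ℝ) + 1) * a + b₁)| ≤ C * ((n : ℝ) + 1) ^ (-δ) ∧
      |lam (2 * n + 1) ^ (-B'⁻¹) - ((2 * (n : ℝ) + 2) * a + b₂)| ≤ C * ((n : ℝ) + 1) ^ (-δ) := by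
  obtain ⟨r₁, r₂, C, N, hr, hl⟩ := hl
  have hpow : ∀ n : ℕ, ((n : ℝ) + 1) ^ (-δ) ≤ 1 := fun n =>
    Real.rpow_le_one_of_one_le_of_nonpos (by linarith [(Nat.cast_nonneg n : (0 : ℝ) ≤ n)])
      (by linarith)
  have hC : ∀ n : ℕ, C * ((n : ℝ) + 1) ^ (-δ) ≤ |C| := fun n =>
    (mul_le_mul_of_nonneg_right (le_abs_self C) (by positivity)).trans
      (mul_le_of_le_one_right (abs_nonneg C) (hpow n))
  have hinv : ∀ x : ℝ, 0 ≤ x → (x ^ (-B')) ^ (-B'⁻¹) = x := fun x hx => by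
    rw [← Real.rpow_mul hx, neg_mul_neg, mul_inv_cancel₀ hB'.ne', Real.rpow_one]
  obtain ⟨N', hN'⟩ := exists_nat_ge ((|C| + |b₁| + |b₂|) / a)
  refine ⟨C, max N N', fun n hn => ?_⟩
  have hnN := (le_max_left _ _).trans hn
  have hna : |C| + |b₁| + |b₂| ≤ n * a := by
    rw [← div_le_iff₀ ha]
    exact hN'.trans (by exact_mod_cast (le_max_right _ _).trans hn)
  have hn0 : (0 : ℝ) ≤ n := Nat.cast_nonneg n
  obtain ⟨h1, h2⟩ := hr n hnN
  have hb₁ := neg_abs_le b₁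
  have hb₂ := neg_abs_le b₂
  have hb₁' := abs_nonneg b₁
  have hb₂' := abs_nonneg b₂
  have h1' := (abs_le.1 (h1.trans (hC n))).1
  have h2' := (abs_le.1 (h2.trans (hC n))).1
  rw [(hl n hnN).1, (hl n hnN).2, hinv _ (by nlinarith), hinv _ (by nlinarith),
    add_sub_cancel_left, add_sub_cancel_left]
  exact ⟨h1, h2⟩

theorem HasTwoSeqAsymp.of_remainder {mu : ℕ → ℝ} {a b₁ b₂ B' δ : ℝ} (hmu : ∀ n, 0 < mu n)
    (hB' : 0 < B') {C : ℝ} {N : ℕ} (h : ∀ n, N ≤ n →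
      |mu (2 * n) ^ (-B'⁻¹) - ((2 * (n : ℝ) + 1) * a + b₁)| ≤ C * ((n : ℝ) + 1) ^ (-δ) ∧
      |mu (2 * n + 1) ^ (-B'⁻¹) - ((2 * (n : ℝ) + 2) * a + b₂)| ≤ C * ((n : ℝ) + 1) ^ (-δ)) :
    HasTwoSeqAsymp mu a b₁ b₂ B' δ := by
  have hinv : ∀ k, mu k = (mu k ^ (-B'⁻¹)) ^ (-B') := fun k => by
    rw [← Real.rpow_mul (hmu k).le, neg_mul_neg, inv_mul_cancel₀ hB'.ne', Real.rpow_one]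
  refine ⟨_, _, C, N, h, fun n _ => ?_⟩
  rw [add_sub_cancel, add_sub_cancel]
  exact ⟨hinv _, hinv _⟩

theorem HasTwoSeqAsymp.exists_abs_sub_le {lam : ℕ → ℝ} {a b₁ b₂ B' δ : ℝ}
    (hl : HasTwoSeqAsymp lam a b₁ b₂ B' δ) (ha : 0 < a) (hB' : 0 < B') (hδ : 0 < δ) :
    ∃ C₀ > 0, ∀ k : ℕ, |lam k ^ (-B'⁻¹) - a * ((k : ℝ) + 1)| ≤ C₀ := by
  obtain ⟨C, N, h⟩ := hl.exists_remainder ha hB' hδ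
  refine exists_forall_le_of_eventually_le (b := |C| + |b₁| + |b₂|) ?_
  filter_upwards [eventually_ge_atTop (2 * N)] with k hk
  have hC : ∀ n : ℕ, C * ((n : ℝ) + 1) ^ (-δ) ≤ |C| := fun n =>
    (mul_le_mul_of_nonneg_right (le_abs_self C) (by positivity)).trans
      (mul_le_of_le_one_right (abs_nonneg C) (Real.rpow_le_one_of_one_le_of_nonpos
        (by linarith [(Nat.cast_nonneg n : (0 : ℝ) ≤ n)]) (by linarith)))
  have hb₁ := abs_nonneg b₁
  have hb₂ := abs_nonneg b₂
  obtain ⟨m, rfl | rfl⟩ := Nat.even_or_odd' k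
  · have h1 := (h m (by omega)).1.trans (hC m)
    calc _ = |(lam (2 * m) ^ (-B'⁻¹) - ((2 * (m : ℝ) + 1) * a + b₁)) + b₁| := by
          push_cast; congr 1; ring
      _ ≤ _ := (abs_add_le _ _).trans (by linarith)
  · have h1 := (h m (by omega)).2.trans (hC m)
    calc _ = |(lam (2 * m + 1) ^ (-B'⁻¹) - ((2 * (m : ℝ) + 2) * a + b₂)) + b₂| := by
          push_cast; congr 1; ring
      _ ≤ _ := (abs_add_le _ _).trans (by linarith)

theorem eventually_abs_rpow_sub_rpow_le {lam mu : ℕ → ℝ} (hl : ∀ n, 0 < lam n)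
    (hm : ∀ n, 0 < mu n) {a C₀ p M δ : ℝ} (hδ : 0 < δ)
    (hν : ∀ k : ℕ, |lam k ^ (-p) - a * ((k : ℝ) + 1)| ≤ C₀)
    (h : ∀ᶠ n : ℕ in atTop, |lam n / mu n - 1| ≤ M * ((n : ℝ) + 1) ^ (-(1 + δ))) :
    ∃ C > 0, ∀ᶠ n : ℕ in atTop, |mu n ^ (-p) - lam n ^ (-p)| ≤ C * ((n : ℝ) + 1) ^ (-δ) := by
  have htend : Tendsto (fun n : ℕ => M * ((n : ℝ) + 1) ^ (-(1 + δ))) atTop (nhds 0) := by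
    rw [← mul_zero M]
    exact Tendsto.const_mul _ ((tendsto_rpow_neg_atTop (by linarith)).comp
      (tendsto_atTop_add_const_right _ _ tendsto_natCast_atTop_atTop))
  have hx : Tendsto (fun n => lam n / mu n) atTop (nhds 1) := by
    rw [tendsto_iff_norm_sub_tendsto_zero]
    exact squeeze_zero' (Eventually.of_forall fun n => norm_nonneg _) h htend
  obtain ⟨c, hc0, hc⟩ := ((Real.hasDerivAt_rpow_const (x := 1) (p := p)
    (Or.inl one_ne_zero)).isBigO_sub.comp_tendsto hx).exists_pos
  refine ⟨max 1 ((a + C₀) * (c * M)), by positivity, ?_⟩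
  filter_upwards [hc.bound, h] with n hn hMn
  simp only [Function.comp_apply, Real.norm_eq_abs, Real.one_rpow] at hn
  have hT : (0 : ℝ) < (n : ℝ) + 1 := by positivity
  have hfac : mu n ^ (-p) - lam n ^ (-p) = lam n ^ (-p) * ((lam n / mu n) ^ p - 1) := by
    rw [Real.div_rpow (hl n).le (hm n).le, Real.rpow_neg (hm n).le, Real.rpow_neg (hl n).le]
    have := Real.rpow_pos_of_pos (hl n) p
    field_simp
  have hpos : 0 < lam n ^ (-p) := Real.rpow_pos_of_pos (hl n) _
  rw [hfac, abs_mul, abs_of_pos hpos]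
  calc lam n ^ (-p) * |(lam n / mu n) ^ p - 1|
      ≤ ((a + C₀) * ((n : ℝ) + 1)) * (c * (M * ((n : ℝ) + 1) ^ (-(1 + δ)))) :=
        mul_le_mul (le_add_mul_succ hν n) (hn.trans (mul_le_mul_of_nonneg_left hMn hc0.le))
          (abs_nonneg _) (hpos.le.trans (le_add_mul_succ hν n))
    _ = (a + C₀) * (c * M) * ((n : ℝ) + 1) ^ (-δ) := by
        rw [show -δ = -(1 + δ) + 1 by ring, Real.rpow_add_one hT.ne']
        ring
    _ ≤ _ := by gcongr; exact le_max_right _ _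

/-- **Remark (for Lemma 1).** If the eigenvalues of `K` (in decreasing order with
multiplicity) are organized in two interlacing sequences
`lam^(1) n = ((2n-1) a + b₁ + O(n^(-δ)))^(-B')`, `lam^(2) n = (2n a + b₂ + O(n^(-δ)))^(-B')`,
and the normalized eigenvectors satisfy `‖B (h n)‖ ≤ c n^(-(1+δ))`, then the eigenvalues of
the generalized eigenproblem `K 𝐡 = 𝛌 (𝐡 + B 𝐡)` are organized in two sequences with the
same two-term asymptotics. -/
theorem remark_two_seq_asymp_preserved_norm
    {H : Type*} [NormedAddCommGroup H] [InnerProductSpace ℝ H] [CompleteSpace H]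
    (K B : H →L[ℝ] H)
    (hKsa : IsSelfAdjoint K) (hBsa : IsSelfAdjoint B)
    (hKcomp : IsCompactOperator (⇑K)) (hBcomp : IsCompactOperator (⇑B))
    (hKpos : ∀ x : H, 0 ≤ ⟪K x, x⟫)
    (hIBpos : ∃ c₀ > (0 : ℝ), ∀ x : H, c₀ * ‖x‖ ^ 2 ≤ ⟪x + B x, x⟫)
    (a b₁ b₂ B' δ c : ℝ) (ha : 0 < a) (hB' : 0 < B') (hδ : 0 < δ) (hc : 0 < c)
    -- `lam` enumerates the eigenvalues of `K` in decreasing order with multiplicity;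
    -- `h` is a corresponding orthonormal basis of eigenvectors
    (lam : ℕ → ℝ) (h : ℕ → H)
    (hlpos : ∀ n, 0 < lam n) (hlanti : Antitone lam)
    (heig : ∀ n, K (h n) = lam n • h n)
    (hon : Orthonormal ℝ h)
    (hcomplete : (Submodule.span ℝ (Set.range h)).topologicalClosure = ⊤)
    -- the asymptotic and perturbation hypotheses
    (hlasymp : HasTwoSeqAsymp lam a b₁ b₂ B' δ)
    (hBh : ∀ᶠ n in atTop, ‖B (h n)‖ ≤ c * ((n : ℝ) + 1) ^ (-(1 + δ)))
    -- `mu` enumerates the eigenvalues of the generalized eigenproblem `K 𝐡 = 𝛌 (𝐡 + B 𝐡)`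
    -- in decreasing order with multiplicity: `g` is a complete system of generalized
    -- eigenvectors, orthonormal with respect to the inner product `⟪x + B x, y⟫`
    (mu : ℕ → ℝ) (g : ℕ → H)
    (hmpos : ∀ n, 0 < mu n) (hmanti : Antitone mu)
    (hgeig : ∀ n, K (g n) = mu n • (g n + B (g n)))
    (hgon : ∀ n m, ⟪g n + B (g n), g m⟫ = if n = m then 1 else 0)
    (hgcomplete : (Submodule.span ℝ (Set.range g)).topologicalClosure = ⊤) :
    HasTwoSeqAsymp mu a b₁ b₂ B' δ := by
  obtain ⟨c₀, hc₀, hIB⟩ := hIBpos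
  have hpos : ∀ x : H, x ≠ 0 → 0 < ⟪x + B x, x⟫ := fun x hx =>
    (mul_pos hc₀ (pow_pos (norm_pos_iff.2 hx) 2)).trans_le (hIB x)
  have hB : ∀ x y, ⟪B x, y⟫ = ⟪x, B y⟫ := fun x y =>
    (ContinuousLinearMap.isSelfAdjoint_iff_isSymmetric.1 hBsa) x y
  obtain ⟨C, hC, hq⟩ : ∃ C > 0, ∀ n : ℕ, ‖B (h n)‖ / ((n : ℝ) + 1) ^ (-(1 + δ)) ≤ C := by
    refine exists_forall_le_of_eventually_le (b := c) (hBh.mono fun n hn => ?_)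
    exact (div_le_iff₀ (by positivity)).2 hn
  replace hq : ∀ n : ℕ, ‖B (h n)‖ ≤ C * ((n : ℝ) + 1) ^ (-(1 + δ)) := fun n =>
    (div_le_iff₀ (by positivity)).1 (hq n)
  obtain ⟨C₀, -, hν⟩ := hlasymp.exists_abs_sub_le ha hB' hδ
  have hν0 : ∀ k, 0 < lam k ^ (-B'⁻¹) := fun k => Real.rpow_pos_of_pos (hlpos k) _
  have hratio : ∀ n k, (lam n ^ (-B'⁻¹) / lam k ^ (-B'⁻¹)) ^ B' = lam k / lam n := fun n k => by
    rw [← Real.div_rpow (hlpos n).le (hlpos k).le, Real.rpow_neg (div_pos (hlpos n) (hlpos k)).le,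
      ← Real.inv_rpow (div_pos (hlpos n) (hlpos k)).le, inv_div,
      Real.rpow_inv_rpow (div_pos (hlpos k) (hlpos n)).le hB'.ne']
  obtain ⟨M, hM, hsum⟩ := exists_eventually_sum_div_le_one ha hν0 hν hB' hC hδ
  have htend : Tendsto (fun n : ℕ => M * ((n : ℝ) + 1) ^ (-(1 + δ))) atTop (nhds 0) := by
    rw [← mul_zero M]
    exact Tendsto.const_mul _ ((tendsto_rpow_neg_atTop (by linarith)).comp
      (tendsto_atTop_add_const_right _ _ tendsto_natCast_atTop_atTop))
  have hrel : ∀ᶠ n : ℕ in atTop, |lam n / mu n - 1| ≤ M * ((n : ℝ) + 1) ^ (-(1 + δ)) := by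
    filter_upwards [hsum, htend.eventually_lt_const one_pos] with n hn hε1
    simp only [hratio] at hn
    have hε : 0 < M * ((n : ℝ) + 1) ^ (-(1 + δ)) := by positivity
    set ε := M * ((n : ℝ) + 1) ^ (-(1 + δ))
    have hup : (1 - ε) * mu n ≤ lam n := by
      have hw : ∀ k, n ≤ k → ε ≤ 1 - (1 - ε) * (lam k / lam n) ∧
          1 - lam k / lam n ≤ 1 - (1 - ε) * (lam k / lam n) := fun k hk => by
        have h1 : lam k / lam n ≤ 1 := (div_le_one (hlpos n)).2 (hlanti hk)
        have h2 : 0 < lam k / lam n := div_pos (hlpos k) (hlpos n)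
        constructor <;> nlinarith
      exact mul_genEigenvalue_le hB hpos hlpos heig hon hcomplete hmanti hgeig hgon hq hε1
        (fun k hk => hε.trans_le (hw k hk).1) (fun k _ => le_rfl) (hn.1 _ hw)
    have hlow : lam n ≤ (1 + ε) * mu n := by
      have hw : ∀ k, k ≤ n → ε ≤ (1 + ε) * (lam k / lam n) - 1 ∧
          lam k / lam n - 1 ≤ (1 + ε) * (lam k / lam n) - 1 := fun k hk => by
        have h1 : 1 ≤ lam k / lam n := (one_le_div (hlpos n)).2 (hlanti hk)
        constructor <;> nlinarith
      exact le_mul_genEigenvalue hB hpos hlpos heig hon hmanti hgeig hgon hgcomplete hq hε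
        (fun k hk => hε.trans_le (hw k hk).1) (fun k _ => le_rfl) (hn.2 _ hw)
    rw [← le_div_iff₀ (hmpos n)] at hup
    rw [← div_le_iff₀ (hmpos n)] at hlow
    exact abs_le.2 ⟨by linarith, by linarith⟩
  obtain ⟨C₁, hC₁, hdiff⟩ := eventually_abs_rpow_sub_rpow_le hlpos hmpos hδ hν hrel
  obtain ⟨N₁, hN₁⟩ := eventually_atTop.1 hdiff
  obtain ⟨C₂, N₂, hrem⟩ := hlasymp.exists_remainder ha hB' hδ
  refine .of_remainder hmpos hB' (C := C₁ + C₂) (N := max N₁ N₂) fun n hn => ?_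
  have hmono : ∀ k : ℕ, n ≤ k → C₁ * ((k : ℝ) + 1) ^ (-δ) ≤ C₁ * ((n : ℝ) + 1) ^ (-δ) :=
    fun k hk => by
      have : (n : ℝ) ≤ k := by exact_mod_cast hk
      exact mul_le_mul_of_nonneg_left
        (Real.rpow_le_rpow_of_nonpos (by positivity) (by linarith) (by linarith)) hC₁.le
  have hn₁ := (le_max_left _ _).trans hn
  obtain ⟨h1, h2⟩ := hrem n ((le_max_right _ _).trans hn)
  simp only [add_mul C₁ C₂]
  exact ⟨(abs_sub_le _ _ _).trans (add_le_add ((hN₁ (2 * n) (by omega)).trans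
      (hmono _ (by omega))) h1),
    (abs_sub_le _ _ _).trans (add_le_add ((hN₁ (2 * n + 1) (by omega)).trans
      (hmono _ (by omega))) h2)⟩
end
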